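/- arXiv:1812.09589 — 3 statements merged into one kernel-verified Lean document; each statement's English description precedes it below -/
import Mathlib

section
/- Let Ω ⊆ ℝ^d be open and connected and let F satisfy conditions (i) and (ii). Assume F has a locally Lipschitz subunit vector field Z : Ω → ℝ^d. If u ∈ USC(Ω) is a viscosity subsolution of F(x,u,Du,D²u) = 0 in Ω attaining a nonnegative maximum at x₀ ∈ Ω, then u(x) = u(x₀) = max_Ω u for every point x = y(s), s ∈ ℝ, where y(·) is the solution of y'(t) = Z(y(t)) with y(0) = x₀. -/
open Set Metric Filter Topology

noncomputable section

/-- Euclidean space `ℝ^d`. -/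
abbrev EV (d : ℕ) := EuclideanSpace ℝ (Fin d)

/-- The outer product `p ⊗ p` as a `d × d` matrix. -/
def outer {d : ℕ} (p : EV d) : Matrix (Fin d) (Fin d) ℝ := Matrix.of fun i j => p i * p j

/-- Euclidean dot product. -/
def dotp {d : ℕ} (p q : EV d) : ℝ := ∑ i, p i * q i

/-- Euclidean gradient. -/
def grad {d : ℕ} (φ : EV d → ℝ) (x : EV d) : EV d :=
  (EuclideanSpace.equiv (Fin d) ℝ).symm fun i => fderiv ℝ φ x (EuclideanSpace.single i 1)

/-- Euclidean Hessian matrix. -/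
def hess {d : ℕ} (φ : EV d → ℝ) (x : EV d) : Matrix (Fin d) (Fin d) ℝ :=
  Matrix.of fun i j =>
    fderiv ℝ (fun y => fderiv ℝ φ y (EuclideanSpace.single j 1)) x (EuclideanSpace.single i 1)

/-- `F` is proper: nondecreasing in `r`, nonincreasing in the matrix argument
(w.r.t. the positive semidefinite order `Y ≤ X ↔ (X - Y).PosSemidef`). -/
def IsProper {d m : ℕ} (Ω : Set (EV d))
    (F : EV d → ℝ → EV m → Matrix (Fin m) (Fin m) ℝ → ℝ) : Prop :=
  ∀ x ∈ Ω, ∀ r s : ℝ, ∀ p : EV m, ∀ X Y : Matrix (Fin m) (Fin m) ℝ,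
    r ≤ s → (X - Y).PosSemidef → F x r p X ≤ F x s p Y

/-- Lower semicontinuity of the operator `F`, jointly in all its arguments. -/
def IsLscOperator {d m : ℕ} (Ω : Set (EV d))
    (F : EV d → ℝ → EV m → Matrix (Fin m) (Fin m) ℝ → ℝ) : Prop :=
  LowerSemicontinuousOn
    (fun q : EV d × ℝ × EV m × Matrix (Fin m) (Fin m) ℝ => F q.1 q.2.1 q.2.2.1 q.2.2.2)
    {q | q.1 ∈ Ω ∧ q.2.2.1 ≠ 0 ∧ q.2.2.2.IsSymm}

/-- Condition (ii) (scaling): for some `φ : (0,1] → (0,∞)`,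
`F(x, ξs, ξp, ξX) ≥ φ(ξ) F(x,s,p,X)` for all `ξ ∈ (0,1]`, `s ∈ [-1,0]`. -/
def HasScaling {d m : ℕ} (Ω : Set (EV d))
    (F : EV d → ℝ → EV m → Matrix (Fin m) (Fin m) ℝ → ℝ) : Prop :=
  ∃ φ : ℝ → ℝ, (∀ ξ ∈ Ioc (0:ℝ) 1, 0 < φ ξ) ∧
    ∀ ξ ∈ Ioc (0:ℝ) 1, ∀ s ∈ Icc (-1:ℝ) 0, ∀ x ∈ Ω, ∀ p : EV m, p ≠ 0 →
      ∀ X : Matrix (Fin m) (Fin m) ℝ, X.IsSymm →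
        φ ξ * F x s p X ≤ F x (ξ * s) (ξ • p) (ξ • X)

/-- Ellipticity condition (elli) for a subelliptic operator `G`. -/
def IsElliptic {d m : ℕ} (Ω : Set (EV d))
    (G : EV d → ℝ → EV m → Matrix (Fin m) (Fin m) ℝ → ℝ) : Prop :=
  ∀ x ∈ Ω, ∀ q : EV m, q ≠ 0 → ∀ X : Matrix (Fin m) (Fin m) ℝ, X.IsSymm →
    ∃ γ : ℝ, 0 < γ ∧ 0 < G x 0 q (X - γ • outer q)

/-- `Z` is a generalized subunit vector for `F` at `x`:
`sup_{γ>0} F(x,0,p, I - γ p⊗p) > 0` whenever `Z·p ≠ 0`. -/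
def IsSubunitAt {d : ℕ} (F : EV d → ℝ → EV d → Matrix (Fin d) (Fin d) ℝ → ℝ)
    (x : EV d) (Z : EV d) : Prop :=
  ∀ p : EV d, dotp Z p ≠ 0 → ∃ γ : ℝ, 0 < γ ∧ 0 < F x 0 p (1 - γ • outer p)

/-- Viscosity subsolution (test functions with nonvanishing gradient). -/
def IsViscSubsol {d : ℕ} (Ω : Set (EV d))
    (F : EV d → ℝ → EV d → Matrix (Fin d) (Fin d) ℝ → ℝ) (u : EV d → ℝ) : Prop :=
  ∀ φ : EV d → ℝ, ContDiff ℝ 2 φ → ∀ x ∈ Ω,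
    IsLocalMaxOn (fun y => u y - φ y) Ω x → grad φ x ≠ 0 →
      F x (u x) (grad φ x) (hess φ x) ≤ 0

/-- Viscosity supersolution (test functions with nonvanishing gradient). -/
def IsViscSupersol {d : ℕ} (Ω : Set (EV d))
    (F : EV d → ℝ → EV d → Matrix (Fin d) (Fin d) ℝ → ℝ) (v : EV d → ℝ) : Prop :=
  ∀ φ : EV d → ℝ, ContDiff ℝ 2 φ → ∀ x ∈ Ω,
    IsLocalMinOn (fun y => v y - φ y) Ω x → grad φ x ≠ 0 →
      0 ≤ F x (v x) (grad φ x) (hess φ x)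

/-- Viscosity subsolution (all `C²` test functions). -/
def IsViscSubsolAll {d : ℕ} (Ω : Set (EV d))
    (F : EV d → ℝ → EV d → Matrix (Fin d) (Fin d) ℝ → ℝ) (u : EV d → ℝ) : Prop :=
  ∀ φ : EV d → ℝ, ContDiff ℝ 2 φ → ∀ x ∈ Ω,
    IsLocalMaxOn (fun y => u y - φ y) Ω x →
      F x (u x) (grad φ x) (hess φ x) ≤ 0

/-- Viscosity supersolution (all `C²` test functions). -/
def IsViscSupersolAll {d : ℕ} (Ω : Set (EV d))
    (F : EV d → ℝ → EV d → Matrix (Fin d) (Fin d) ℝ → ℝ) (v : EV d → ℝ) : Prop :=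
  ∀ φ : EV d → ℝ, ContDiff ℝ 2 φ → ∀ x ∈ Ω,
    IsLocalMinOn (fun y => v y - φ y) Ω x →
      0 ≤ F x (v x) (grad φ x) (hess φ x)

/-- Locally Lipschitz on a set. -/
def LocLipschitzOn {α β : Type*} [PseudoMetricSpace α] [PseudoMetricSpace β]
    (f : α → β) (s : Set α) : Prop :=
  ∀ x ∈ s, ∃ K : NNReal, ∃ ε : ℝ, 0 < ε ∧ LipschitzOnWith K f (s ∩ Metric.ball x ε)

/-- Admissible controls: measurable, with `∑ i βᵢ(t)² ≤ 1`. -/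
def Admissible {m : ℕ} (β : ℝ → Fin m → ℝ) : Prop :=
  (∀ i, Measurable fun t => β t i) ∧ ∀ t : ℝ, ∑ i, (β t i) ^ 2 ≤ 1

/-- (Carathéodory) trajectory of the control system `y' = ∑ᵢ βᵢ Zᵢ(y)` on `[0, T]`. -/
def IsTrajOn {d m : ℕ} (Z : Fin m → EV d → EV d) (β : ℝ → Fin m → ℝ)
    (y : ℝ → EV d) (T : ℝ) : Prop :=
  ContinuousOn y (Icc 0 T) ∧
    ∀ t ∈ Icc 0 T, y t = y 0 + ∫ s in (0:ℝ)..t, ∑ i, β s i • Z i (y s)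

/-- `x₁` is reachable from `x₀` by the control system, with trajectory staying in `Ω`. -/
def ReachableIn {d m : ℕ} (Ω : Set (EV d)) (Z : Fin m → EV d → EV d)
    (x₀ x₁ : EV d) : Prop :=
  ∃ (β : ℝ → Fin m → ℝ) (y : ℝ → EV d) (T : ℝ), 0 ≤ T ∧ Admissible β ∧
    IsTrajOn Z β y T ∧ (∀ t ∈ Icc 0 T, y t ∈ Ω) ∧ y 0 = x₀ ∧ y T = x₁

/-- Bounded time controllability in `Ω`. -/
def BTC {d m : ℕ} (Ω : Set (EV d)) (Z : Fin m → EV d → EV d) : Prop :=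
  ∀ x₀ ∈ Ω, ∀ x₁ ∈ Ω, ReachableIn Ω Z x₀ x₁

/-- Generalized exterior (Bony, proximal) normal `ν` to `K` at `z`. -/
def IsExtNormal {d : ℕ} (K : Set (EV d)) (z ν : EV d) : Prop :=
  z ∈ frontier K ∧ ‖ν‖ = 1 ∧
    ∃ t : ℝ, 0 < t ∧ Metric.closedBall (z + t • ν) t ∩ closure K = {z}

/-- Lie bracket of two vector fields. -/
def vfBracket {d : ℕ} (X Y : EV d → EV d) : EV d → EV d :=
  fun x => fderiv ℝ Y x (X x) - fderiv ℝ X x (Y x)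

/-- Vector fields obtained from `Z₁,…,Z_m` by iterated Lie brackets. -/
inductive LieGenerated {d m : ℕ} (Z : Fin m → EV d → EV d) : (EV d → EV d) → Prop
  | base (i : Fin m) : LieGenerated Z (Z i)
  | bracket {X Y : EV d → EV d} :
      LieGenerated Z X → LieGenerated Z Y → LieGenerated Z (vfBracket X Y)

/-- Hörmander condition: the fields and their iterated brackets span `ℝ^d` at every point of `Ω`. -/
def Hormander {d m : ℕ} (Ω : Set (EV d)) (Z : Fin m → EV d → EV d) : Prop :=
  ∀ x ∈ Ω, Submodule.span ℝ {v : EV d | ∃ W, LieGenerated Z W ∧ W x = v} = ⊤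

/-- Intrinsic (horizontal) gradient `σ(x)ᵀ p`. -/
def sigmaT {d m : ℕ} (σ : Fin m → EV d → EV d) (x : EV d) (p : EV d) : EV m :=
  (EuclideanSpace.equiv (Fin m) ℝ).symm fun j => ∑ i, σ j x i * p i

/-- `σ(x)ᵀ X σ(x)` as an `m × m` matrix. -/
def sigmaHess {d m : ℕ} (σ : Fin m → EV d → EV d) (x : EV d)
    (X : Matrix (Fin d) (Fin d) ℝ) : Matrix (Fin m) (Fin m) ℝ :=
  Matrix.of fun j k => ∑ i, ∑ l, σ j x i * X i l * σ k x l

/-- First-order correction term `g(x,p)` of the symmetrized intrinsic Hessian. -/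
def corrTerm {d m : ℕ} (σ : Fin m → EV d → EV d) (x : EV d) (p : EV d) :
    Matrix (Fin m) (Fin m) ℝ :=
  Matrix.of fun j k =>
    ((∑ i, (fderiv ℝ (σ k) x (σ j x)) i * p i) +
      (∑ i, (fderiv ℝ (σ j) x (σ k x)) i * p i)) / 2

/-- Euclidean form `F(x,r,p,X) = G(x, r, σᵀp, σᵀXσ + g(x,p))` of a subelliptic operator. -/
def euclOp {d m : ℕ} (σ : Fin m → EV d → EV d)
    (G : EV d → ℝ → EV m → Matrix (Fin m) (Fin m) ℝ → ℝ) :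
    EV d → ℝ → EV d → Matrix (Fin d) (Fin d) ℝ → ℝ :=
  fun x r p X => G x r (sigmaT σ x p) (sigmaHess σ x X + corrTerm σ x p)

/-- `A ≥ Z ⊗ Z` in the quadratic-form sense: `ξᵀAξ ≥ (Z·ξ)²` for all `ξ`. -/
def matGEouter {d : ℕ} (A : Matrix (Fin d) (Fin d) ℝ) (Z : EV d) : Prop :=
  ∀ ξ : EV d, (dotp Z ξ) ^ 2 ≤ ∑ i, ∑ j, A i j * ξ i * ξ j

/-- A relatively closed set is locally forward invariant under the flow of a locally Lipschitz
field that is orthogonal to all proximal normals of the set. -/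
theorem eventually_mem_of_orthogonal_proximal_normals {E : Type*} [NormedAddCommGroup E]
    [InnerProductSpace ℝ E] [ProperSpace E] {Ω C : Set E} (hΩ : IsOpen Ω) (hC : IsClosed C)
    {W : E → E} (hW : LocLipschitzOn W Ω)
    (horth : ∀ z ∈ Ω ∩ C, ∀ c : E, (∀ᶠ x in 𝓝 z, x ∈ Ω ∩ C → ‖z - c‖ ≤ ‖x - c‖) →
      inner ℝ (W z) (z - c) = 0)
    {y : ℝ → E} (hode : ∀ t, HasDerivAt y (W (y t)) t) {t₀ : ℝ} (ht₀ : y t₀ ∈ Ω ∩ C) :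
    ∀ᶠ t in 𝓝[>] t₀, y t ∈ Ω ∩ C := by
  obtain ⟨L, ε, hε, hLip⟩ := hW _ ht₀.1
  obtain ⟨ε', hε', hball⟩ := Metric.isOpen_iff.1 hΩ _ ht₀.1
  set z₀ := y t₀ with hz₀
  obtain ⟨r, hr, hrlt⟩ := exists_between (lt_min hε hε')
  have hrΩ : closedBall z₀ r ⊆ Ω :=
    (closedBall_subset_ball (hrlt.trans_le (min_le_right _ _))).trans hball
  have hLip' : LipschitzOnWith L W (closedBall z₀ r) := hLip.mono <| subset_inter hrΩ
    (closedBall_subset_ball (hrlt.trans_le (min_le_left _ _)))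
  set K := C ∩ closedBall z₀ r with hK
  have hKc : IsCompact K := (isCompact_closedBall _ _).inter_left hC
  have hz₀K : z₀ ∈ K := ⟨ht₀.2, mem_closedBall_self hr.le⟩
  have hKne : K.Nonempty := ⟨z₀, hz₀K⟩
  have hKsub : K ⊆ Ω ∩ C := fun x hx => ⟨hrΩ hx.2, hx.1⟩
  have hycont : Continuous y := continuous_iff_continuousAt.2 fun t => (hode t).continuousAt
  have hnear : ∀ᶠ t in 𝓝 t₀, y t ∈ ball z₀ (r / 2) :=
    hycont.continuousAt (ball_mem_nhds _ (half_pos hr))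
  obtain ⟨τ, hτ, hτball⟩ := Metric.eventually_nhds_iff.1 hnear
  have hgron := le_gronwallBound_of_liminf_deriv_right_le (a := t₀) (b := t₀ + τ / 2)
    (f := fun t => infDist (y t) K ^ 2)
    (f' := fun t => 2 * L * infDist (y t) K ^ 2) (δ := 0) (K := 2 * L) (ε := 0)
    (((continuous_infDist_pt K).comp hycont).pow 2).continuousOn ?_
    (by simp [← hz₀, infDist_zero_of_mem hz₀K]) (by simp)
  · have hIoo : Ioo t₀ (t₀ + τ / 2) ∈ 𝓝[>] t₀ := Ioo_mem_nhdsGT (by linarith)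
    filter_upwards [hIoo] with t ht
    have h := hgron t ⟨ht.1.le, ht.2.le⟩
    rw [gronwallBound_ε0_δ0] at h
    have h0 : infDist (y t) K = 0 := by
      have := sq_nonneg (infDist (y t) K)
      exact pow_eq_zero_iff (two_ne_zero) |>.1 (le_antisymm h this)
    exact hKsub ((hKc.isClosed.mem_iff_infDist_zero hKne).2 h0)
  · intro t ht ρ hρ
    have hyt : y t ∈ ball z₀ (r / 2) := by
      apply hτball
      rw [Real.dist_eq, abs_of_nonneg (by linarith [ht.1])]
      linarith [ht.2]
    obtain ⟨z, hzK, hz⟩ := hKc.exists_infDist_eq_dist hKne (y t)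
    have hzball : z ∈ ball z₀ r := by
      have h1 : infDist (y t) K ≤ dist (y t) z₀ := infDist_le_dist_of_mem hz₀K
      have h2 := dist_triangle z (y t) z₀
      rw [mem_ball] at hyt ⊢
      rw [dist_comm z (y t)] at h2
      linarith
    have hnormal : inner ℝ (W z) (z - y t) = 0 := by
      refine horth z (hKsub hzK) _ ?_
      filter_upwards [isOpen_ball.mem_nhds hzball] with x hx hxK
      have : infDist (y t) K ≤ dist (y t) x :=
        infDist_le_dist_of_mem ⟨hxK.2, ball_subset_closedBall hx⟩
      rwa [hz, dist_comm, dist_comm (y t) x, dist_eq_norm, dist_eq_norm] at this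
    have hderiv : HasDerivAt (fun s => ‖y s - z‖ ^ 2) (2 * inner ℝ (y t - z) (W (y t))) t :=
      ((hode t).sub_const z).norm_sq
    have hbound : 2 * inner ℝ (y t - z) (W (y t)) < ρ := by
      refine lt_of_le_of_lt ?_ hρ
      have h1 : inner ℝ (y t - z) (W (y t)) = inner ℝ (y t - z) (W (y t) - W z) := by
        rw [inner_sub_right, real_inner_comm (W z), ← neg_sub z (y t), inner_neg_right (W z),
          hnormal, neg_zero, sub_zero]
      have h2 : ‖W (y t) - W z‖ ≤ L * ‖y t - z‖ := hLip'.norm_sub_le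
        (ball_subset_closedBall (ball_subset_ball (by linarith) hyt)) hzK.2
      have h3 := real_inner_le_norm (y t - z) (W (y t) - W z)
      have h4 := mul_le_mul_of_nonneg_left h2 (norm_nonneg (y t - z))
      rw [h1, hz, dist_eq_norm]
      nlinarith
    have hslope := (hasDerivWithinAt_iff_tendsto_slope' self_notMem_Ioi).1
      (hderiv.hasDerivWithinAt (s := Ioi t))
    refine Eventually.frequently ?_
    filter_upwards [hslope (Iio_mem_nhds hbound), self_mem_nhdsWithin] with s hs hts
    refine lt_of_le_of_lt ?_ hs
    rw [slope_def_field, div_eq_inv_mul]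
    have hpos : 0 ≤ (s - t)⁻¹ := inv_nonneg.2 (sub_nonneg.2 (le_of_lt hts))
    refine mul_le_mul_of_nonneg_left ?_ hpos
    rw [hz, ← dist_eq_norm, ← dist_eq_norm]
    gcongr
    exacts [infDist_nonneg, infDist_le_dist_of_mem hzK]

/-- Forward invariance of a relatively closed set under the flow of a locally Lipschitz field
that is orthogonal to all proximal normals of the set. -/
theorem mem_of_orthogonal_proximal_normals {E : Type*} [NormedAddCommGroup E]
    [InnerProductSpace ℝ E] [ProperSpace E] {Ω C : Set E} (hΩ : IsOpen Ω) (hC : IsClosed C)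
    {W : E → E} (hW : LocLipschitzOn W Ω)
    (horth : ∀ z ∈ Ω ∩ C, ∀ c : E, (∀ᶠ x in 𝓝 z, x ∈ Ω ∩ C → ‖z - c‖ ≤ ‖x - c‖) →
      inner ℝ (W z) (z - c) = 0)
    {y : ℝ → E} (hode : ∀ t, HasDerivAt y (W (y t)) t) (hyΩ : ∀ t, y t ∈ Ω) (h0 : y 0 ∈ C)
    {t : ℝ} (ht : 0 ≤ t) : y t ∈ C := by
  have hycont : Continuous y := continuous_iff_continuousAt.2 fun t => (hode t).continuousAt
  refine IsClosed.Icc_subset_of_forall_mem_nhdsWithin (s := y ⁻¹' C)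
    ((hC.preimage hycont).inter isClosed_Icc) h0 (fun s hs => ?_) (right_mem_Icc.2 ht)
  filter_upwards [eventually_mem_of_orthogonal_proximal_normals hΩ hC hW horth hode
    ⟨hyΩ s, hs.1⟩] with x hx using hx.2

theorem dotp_eq_inner {d : ℕ} (p q : EV d) : dotp p q = inner ℝ p q := by
  simp [dotp, PiLp.inner_apply, mul_comm]

/-- Half the power of a point `x` with respect to the sphere centred at `c` through `z`. -/
def halfPower {d : ℕ} (c z x : EV d) : ℝ := (‖x - c‖ ^ 2 - ‖z - c‖ ^ 2) / 2

/-- The barrier `h - (γ/2) h²`, where `h` is `halfPower c z`. -/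
def barrier {d : ℕ} (c z : EV d) (γ : ℝ) (x : EV d) : ℝ :=
  halfPower c z x - γ / 2 * halfPower c z x ^ 2

theorem hasFDerivAt_halfPower {d : ℕ} (c z x : EV d) :
    HasFDerivAt (halfPower c z) (innerSL ℝ (x - c)) x := by
  have h := (((((hasFDerivAt_id x).sub_const c).norm_sq).sub_const (‖z - c‖ ^ 2)).const_mul
    (1 / 2 : ℝ))
  refine (h.congr_of_eventuallyEq (Eventually.of_forall fun y => ?_)).congr_fderiv ?_
  · simp [halfPower]; ring
  · ext v; simp

theorem continuous_halfPower {d : ℕ} (c z : EV d) : Continuous (halfPower c z) := by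
  unfold halfPower; fun_prop

theorem contDiff_barrier {d : ℕ} (c z : EV d) (γ : ℝ) : ContDiff ℝ 2 (barrier c z γ) := by
  have : ContDiff ℝ 2 (halfPower c z) := by
    unfold halfPower
    exact (((contDiff_id.sub contDiff_const).norm_sq ℝ).sub contDiff_const).div_const 2
  unfold barrier
  fun_prop

theorem continuous_barrier {d : ℕ} (c z : EV d) (γ : ℝ) : Continuous (barrier c z γ) :=
  (contDiff_barrier c z γ).continuous

theorem fderiv_affine_barrier {d : ℕ} (c z : EV d) (γ M ε : ℝ) (x : EV d) :
    fderiv ℝ (fun y => M + ε * barrier c z γ y) x =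
      (ε * (1 - γ * halfPower c z x)) • innerSL ℝ (x - c) := by
  have h := hasFDerivAt_halfPower c z x
  have h' := ((h.sub ((h.pow 2).const_mul (γ / 2))).const_mul ε).const_add M
  refine (HasFDerivAt.fderiv (h'.congr_of_eventuallyEq
    (Eventually.of_forall fun y => ?_))).trans ?_
  · simp [barrier]
  · ext v
    simp
    ring

theorem fderiv_affine_barrier_single {d : ℕ} (c z : EV d) (γ M ε : ℝ) (x : EV d) (i : Fin d) :
    fderiv ℝ (fun y => M + ε * barrier c z γ y) x (EuclideanSpace.single i 1) =
      ε * (1 - γ * halfPower c z x) * (x i - c i) := by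
  rw [fderiv_affine_barrier, smul_apply, innerSL_apply_apply,
    EuclideanSpace.inner_single_right]
  simp

theorem grad_affine_barrier {d : ℕ} (c z : EV d) (γ M ε : ℝ) (x : EV d) :
    grad (fun y => M + ε * barrier c z γ y) x =
      ε • ((1 - γ * halfPower c z x) • (x - c)) := by
  ext i
  simp only [grad, fderiv_affine_barrier_single]
  simp [mul_assoc]

theorem hess_affine_barrier {d : ℕ} (c z : EV d) (γ M ε : ℝ) (x : EV d) :
    hess (fun y => M + ε * barrier c z γ y) x =
      ε • ((1 - γ * halfPower c z x) • (1 : Matrix (Fin d) (Fin d) ℝ) -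
        γ • outer (x - c)) := by
  ext i j
  have h1 := ((((hasFDerivAt_halfPower c z x).const_mul γ).const_sub 1).const_mul ε)
  have h2 : HasFDerivAt (fun y : EV d => y j - c j)
      (EuclideanSpace.proj j : EV d →L[ℝ] ℝ) x :=
    (EuclideanSpace.proj j : EV d →L[ℝ] ℝ).hasFDerivAt.sub_const (c j)
  have h3 : HasFDerivAt (fun y => ε * (1 - γ * halfPower c z y) * (y j - c j)) _ x := h1.mul h2
  simp only [hess, fderiv_affine_barrier_single, Matrix.of_apply, h3.fderiv]
  simp [outer, Matrix.one_apply, EuclideanSpace.inner_single_right, eq_comm (a := i)]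
  split_ifs <;> ring

/-- Hopf-type lemma: at an interior maximum point `z` touched by a ball centred at `c` on which
the maximum is attained only at `z`, every subunit vector is orthogonal to `z - c`. -/
theorem dotp_eq_zero_of_strict_max {d : ℕ} {Ω : Set (EV d)} (hΩ : IsOpen Ω)
    {F : EV d → ℝ → EV d → Matrix (Fin d) (Fin d) ℝ → ℝ}
    (hFlsc : IsLscOperator Ω F) (hFprop : IsProper Ω F) (hFscal : HasScaling Ω F)
    {u : EV d → ℝ} (husc : UpperSemicontinuousOn u Ω) (hsub : IsViscSubsol Ω F u)
    {M : ℝ} (hmax : ∀ x ∈ Ω, u x ≤ M) (hM : 0 ≤ M) {z c V : EV d} (hz : z ∈ Ω) (huz : u z = M)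
    (hV : IsSubunitAt F z V)
    (hstrict : ∀ᶠ x in 𝓝 z, x ≠ z → ‖x - c‖ ≤ ‖z - c‖ → u x < M) :
    dotp V (z - c) = 0 := by
  by_contra hne
  obtain ⟨γ, hγ, hpos⟩ := hV _ hne
  have hzc : z - c ≠ 0 := by
    intro h
    simp [h, dotp] at hne
  have hh := continuous_halfPower c z
  have hw := continuous_barrier c z γ
  have hh0 : halfPower c z z = 0 := by simp [halfPower]
  have hw0 : barrier c z γ z = 0 := by simp [barrier, hh0]
  set P : EV d → EV d := fun x => (1 - γ * halfPower c z x) • (x - c) with hP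
  set X : EV d → Matrix (Fin d) (Fin d) ℝ := fun x =>
    (1 - γ * halfPower c z x) • (1 : Matrix (Fin d) (Fin d) ℝ) - γ • outer (x - c) with hX
  have hPc : Continuous P := by fun_prop
  have houter : Continuous fun x : EV d => outer (x - c) := by
    unfold outer
    refine continuous_matrix fun i j => ?_
    simp only [Matrix.of_apply]
    fun_prop
  have hXc : Continuous X := by fun_prop
  have hXsymm : ∀ x, (X x).IsSymm := by
    intro x
    ext i j
    simp [hX, outer, Matrix.one_apply, eq_comm (a := i), mul_comm]
  have hP0 : P z = z - c := by simp [hP, hh0]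
  have hX0 : X z = 1 - γ • outer (z - c) := by simp [hX, hh0]
  have hPne : ∀ᶠ x in 𝓝 z, P x ≠ 0 :=
    hPc.continuousAt.eventually_ne (by rwa [hP0])
  have hΩz : ∀ᶠ x in 𝓝 z, x ∈ Ω := hΩ.mem_nhds hz
  have hFpos : ∀ᶠ x in 𝓝 z, 0 < F x (barrier c z γ x) (P x) (X x) := by
    have hl := hFlsc (z, 0, z - c, 1 - γ • outer (z - c))
      ⟨hz, hzc, by rw [← hX0]; exact hXsymm z⟩ 0 hpos
    have hcont : Tendsto (fun x => (x, barrier c z γ x, P x, X x)) (𝓝 z)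
        (𝓝 (z, 0, z - c, 1 - γ • outer (z - c))) := by
      have : Continuous fun x => (x, barrier c z γ x, P x, X x) := by fun_prop
      have := this.tendsto z
      rwa [hw0, hP0, hX0] at this
    refine (tendsto_nhdsWithin_iff.2 ⟨hcont, ?_⟩).eventually hl
    filter_upwards [hPne, hΩz] with x h1 h2 using ⟨h2, h1, hXsymm x⟩
  have hhsmall : ∀ᶠ x in 𝓝 z, γ * halfPower c z x < 2 :=
    (continuous_const.mul hh).continuousAt.eventually_lt continuousAt_const (by simp [hh0])
  have hwlow : ∀ᶠ x in 𝓝 z, -1 < barrier c z γ x :=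
    continuousAt_const.eventually_lt hw.continuousAt (by simp [hw0])
  obtain ⟨r, hr, hall⟩ := Metric.nhds_basis_closedBall.eventually_iff.1
    (hstrict.and (hPne.and (hΩz.and (hFpos.and (hhsmall.and hwlow)))))
  have hsubΩ : closedBall z r ⊆ Ω := fun x hx => (hall hx).2.2.1
  obtain ⟨ε, hε0, hε1, hε⟩ : ∃ ε : ℝ, 0 < ε ∧ ε ≤ 1 ∧
      ∀ x ∈ sphere z r ∩ closedBall c ‖z - c‖, u x + ε < M := by
    rcases (sphere z r ∩ closedBall c ‖z - c‖).eq_empty_or_nonempty with he | hne'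
    · exact ⟨1, one_pos, le_rfl, by simp [he]⟩
    · obtain ⟨a, ha, hamax⟩ := UpperSemicontinuousOn.exists_isMaxOn hne'
        ((isCompact_sphere z r).inter_right isClosed_closedBall)
        (husc.mono ((inter_subset_left.trans sphere_subset_closedBall).trans hsubΩ))
      have hua : u a < M := (hall (sphere_subset_closedBall ha.1)).1
        (ne_of_mem_sphere ha.1 hr.ne') (by simpa [dist_eq_norm] using ha.2)
      refine ⟨min 1 ((M - u a) / 2), lt_min one_pos (by linarith), min_le_left _ _, ?_⟩
      intro x hx
      have := hamax hx
      have h2 := min_le_right 1 ((M - u a) / 2)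
      simp only [mem_ofPred_eq] at this
      linarith
  have husc' : UpperSemicontinuousOn (fun x => u x + -(M + ε * barrier c z γ x))
      (closedBall z r) := by
    have : Continuous fun x => -(M + ε * barrier c z γ x) := by fun_prop
    exact (husc.mono hsubΩ).add (this.upperSemicontinuous.upperSemicontinuousOn _)
  obtain ⟨x, hx, hxmax⟩ := UpperSemicontinuousOn.exists_isMaxOn
    ⟨z, mem_closedBall_self hr.le⟩ (isCompact_closedBall z r) husc'
  have hge : M + ε * barrier c z γ x ≤ u x := by
    have := hxmax (mem_closedBall_self hr.le)
    simp only [mem_ofPred_eq, hw0, huz] at this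
    linarith
  obtain ⟨-, hxP, hxΩ, hxF, hxh, hxw⟩ := hall hx
  have hwnonpos : barrier c z γ x ≤ 0 := by
    have := hmax x hxΩ
    nlinarith
  have hxball : x ∈ ball z r := by
    refine lt_of_le_of_ne (mem_closedBall.1 hx) fun hxs => ?_
    by_cases hxc : ‖x - c‖ ≤ ‖z - c‖
    · have := hε x ⟨hxs, by simpa [dist_eq_norm] using hxc⟩
      nlinarith
    · have hhpos : 0 < halfPower c z x := by
        unfold halfPower
        have := norm_nonneg (z - c)
        nlinarith
      have : barrier c z γ x = halfPower c z x * (2 - γ * halfPower c z x) / 2 := by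
        unfold barrier; ring
      nlinarith [mul_pos hhpos (sub_pos.2 hxh)]
  have hlocal : IsLocalMaxOn (fun y => u y - (M + ε * barrier c z γ y)) Ω x := by
    have : IsLocalMax (fun y => u y - (M + ε * barrier c z γ y)) x := by
      filter_upwards [isOpen_ball.mem_nhds hxball] with y hy
      simpa [sub_eq_add_neg] using hxmax (ball_subset_closedBall hy)
    exact this.on Ω
  have htest := hsub _ (contDiff_const.add (contDiff_const.mul (contDiff_barrier c z γ))) x hxΩ
    hlocal (by rw [grad_affine_barrier]; exact smul_ne_zero hε0.ne' hxP)
  rw [grad_affine_barrier, hess_affine_barrier] at htest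
  obtain ⟨φ, hφ, hscal⟩ := hFscal
  have h1 := hscal ε ⟨hε0, hε1⟩ _ ⟨hxw.le, hwnonpos⟩ x hxΩ (P x) hxP (X x) (hXsymm x)
  have h2 := hFprop x hxΩ (ε * barrier c z γ x) (u x) (ε • P x) (ε • X x) (ε • X x)
    (by linarith) (by rw [sub_self]; exact Matrix.PosSemidef.zero)
  have h3 := mul_pos (hφ ε ⟨hε0, hε1⟩) hxF
  linarith

/-- At an interior maximum point `z` lying on the boundary of a ball centred at `c` in which the
maximum is not attained, every subunit vector is orthogonal to `z - c`. -/
theorem dotp_eq_zero_of_proximal_normal {d : ℕ} {Ω : Set (EV d)} (hΩ : IsOpen Ω)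
    {F : EV d → ℝ → EV d → Matrix (Fin d) (Fin d) ℝ → ℝ}
    (hFlsc : IsLscOperator Ω F) (hFprop : IsProper Ω F) (hFscal : HasScaling Ω F)
    {u : EV d → ℝ} (husc : UpperSemicontinuousOn u Ω) (hsub : IsViscSubsol Ω F u)
    {M : ℝ} (hmax : ∀ x ∈ Ω, u x ≤ M) (hM : 0 ≤ M) {z c V : EV d} (hz : z ∈ Ω) (huz : u z = M)
    (hV : IsSubunitAt F z V)
    (hball : ∀ᶠ x in 𝓝 z, ‖x - c‖ < ‖z - c‖ → u x < M) :
    dotp V (z - c) = 0 := by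
  have h := dotp_eq_zero_of_strict_max hΩ hFlsc hFprop hFscal husc hsub hmax hM hz huz hV
    (c := z - (1 / 2 : ℝ) • (z - c)) (by
      filter_upwards [hball] with x hx hxz hle
      apply hx
      set p := z - c
      set v := x - z
      have hv : 0 < ‖v‖ := norm_pos_iff.2 (sub_ne_zero.2 hxz)
      have e1 : x - (z - (1 / 2 : ℝ) • p) = v + (1 / 2 : ℝ) • p := by simp only [v]; abel
      have e2 : z - (z - (1 / 2 : ℝ) • p) = (1 / 2 : ℝ) • p := by abel
      have e3 : x - c = v + p := by simp only [v, p]; abel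
      rw [e1, e2] at hle
      rw [e3]
      have hsq := pow_le_pow_left₀ (norm_nonneg _) hle 2
      rw [norm_add_sq_real, inner_smul_right] at hsq
      refine lt_of_pow_lt_pow_left₀ 2 (norm_nonneg _) ?_
      rw [norm_add_sq_real]
      nlinarith [pow_pos hv 2])
  rw [sub_sub_cancel, dotp_eq_inner, inner_smul_right] at h
  rw [dotp_eq_inner]
  linarith

/-- Theorem 1.2: propagation of interior maxima of viscosity subsolutions
along the trajectories of a locally Lipschitz subunit vector field. -/
theorem propagation_along_subunit_field {d : ℕ} (Ω : Set (EV d))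
    (hΩ : IsOpen Ω) (hconn : IsConnected Ω)
    (F : EV d → ℝ → EV d → Matrix (Fin d) (Fin d) ℝ → ℝ)
    (hFlsc : IsLscOperator Ω F) (hFprop : IsProper Ω F) (hFscal : HasScaling Ω F)
    (Z : EV d → EV d) (hZlip : LocLipschitzOn Z Ω)
    (hZsv : ∀ x ∈ Ω, IsSubunitAt F x (Z x))
    (u : EV d → ℝ) (husc : UpperSemicontinuousOn u Ω)
    (hsub : IsViscSubsol Ω F u)
    (x₀ : EV d) (hx₀ : x₀ ∈ Ω) (hmax : ∀ x ∈ Ω, u x ≤ u x₀) (hnn : 0 ≤ u x₀)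
    (y : ℝ → EV d) (hy0 : y 0 = x₀) (hyΩ : ∀ t : ℝ, y t ∈ Ω)
    (hode : ∀ t : ℝ, HasDerivAt y (Z (y t)) t) :
    ∀ s : ℝ, u (y s) = u x₀ := by
  obtain ⟨C, hC, hCeq⟩ := upperSemicontinuousOn_iff_preimage_Ici.1 husc (u x₀)
  have hmem : ∀ x ∈ Ω, x ∈ C ↔ u x = u x₀ := by
    intro x hx
    have := Set.ext_iff.1 hCeq x
    simp only [mem_inter_iff, hx, true_and, mem_preimage, mem_Ici] at this
    exact this.symm.trans ⟨fun h => le_antisymm (hmax x hx) h, fun h => h.ge⟩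
  have horth : ∀ z ∈ Ω ∩ C, ∀ c : EV d,
      (∀ᶠ x in 𝓝 z, x ∈ Ω ∩ C → ‖z - c‖ ≤ ‖x - c‖) → inner ℝ (Z z) (z - c) = 0 := by
    intro z hz c hc
    rw [← dotp_eq_inner]
    refine dotp_eq_zero_of_proximal_normal hΩ hFlsc hFprop hFscal husc hsub hmax hnn hz.1
      ((hmem z hz.1).1 hz.2) (hZsv z hz.1) ?_
    filter_upwards [hc, hΩ.mem_nhds hz.1] with x hx hxΩ hlt
    exact lt_of_le_of_ne (hmax x hxΩ) fun h => (hx ⟨hxΩ, (hmem x hxΩ).2 h⟩).not_gt hlt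
  have h0 : y 0 ∈ C := (hmem _ (hyΩ 0)).2 (by rw [hy0])
  intro s
  refine (hmem _ (hyΩ s)).1 ?_
  rcases le_total 0 s with hs | hs
  · exact mem_of_orthogonal_proximal_normals hΩ hC hZlip horth hode hyΩ h0 hs
  · have hneg : LocLipschitzOn (fun x => -Z x) Ω := by
      intro x hx
      obtain ⟨K, ε, hε, hK⟩ := hZlip x hx
      exact ⟨K, ε, hε, hK.neg⟩
    have := mem_of_orthogonal_proximal_normals hΩ hC hneg
      (fun z hz c hc => by rw [inner_neg_left, horth z hz c hc, neg_zero])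
      (y := fun t => y (-t)) (fun t => by
        simpa [Function.comp_def] using (hode (-t)).scomp t (hasDerivAt_neg t))
      (fun t => hyΩ (-t)) (by simpa using h0) (neg_nonneg.2 hs)
    simpa using this
end
end

section
/- Let Ω ⊆ ℝ^d be open and connected and let F satisfy conditions (i) and (ii). Assume there exist subunit vector fields Z₁,…,Z_m of F that are C^∞ and satisfy the Hörmander condition on Ω. Then any viscosity subsolution u ∈ USC(Ω) of F(x,u,Du,D²u) = 0 attaining a nonnegative maximum in Ω is constant. -/
open Set Metric Filter Topology

noncomputable section

section Invariance

open Asymptotics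

variable {E : Type*} [NormedAddCommGroup E]

/-- `z` is a point of `K` nearest to `c`, and the ball centred at `c` through `z` lies in `Ω`;
equivalently, `c - z` is a proximal normal to `K` at `z` realised inside `Ω`. -/
def IsProximalCenter (Ω K : Set E) (z c : E) : Prop :=
  z ∈ K ∧ closedBall c (dist z c) ⊆ Ω ∧ ∀ y ∈ K, dist z c ≤ dist y c

/-- `K` meets each closed ball contained in `Ω` in a compact set. -/
def IsLocallyCompactIn (Ω K : Set E) : Prop :=
  ∀ z r, closedBall z r ⊆ Ω → IsCompact (K ∩ closedBall z r)

variable {Ω K : Set E} {z : E}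

theorem IsLocallyCompactIn.exists_isProximalCenter (hK : IsLocallyCompactIn Ω K) {r : ℝ} {c : E}
    (hz : z ∈ K) (hΩ : closedBall z (2 * r) ⊆ Ω) (hc : dist c z ≤ r) :
    ∃ k ∈ closedBall z (2 * r), IsProximalCenter Ω K k c ∧ infDist c K = dist k c := by
  have hr : 0 ≤ r := dist_nonneg.trans hc
  obtain ⟨k, ⟨hkK, hkz⟩, hk⟩ := (hK z _ hΩ).exists_isMinOn
    ⟨z, hz, mem_closedBall_self (by positivity)⟩
    (continuous_id.dist (continuous_const (y := c))).continuousOn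
  have hkmin : ∀ y ∈ K, dist k c ≤ dist y c := by
    intro y hy
    by_cases hyz : y ∈ closedBall z (2 * r)
    · exact hk ⟨hy, hyz⟩
    · have h1 : dist k c ≤ dist z c := hk ⟨hz, mem_closedBall_self (by positivity)⟩
      rw [mem_closedBall, not_le] at hyz
      have h2 := dist_triangle y c z
      rw [dist_comm z c] at h1
      linarith
  refine ⟨k, hkz, ⟨hkK, fun y hy => hΩ ?_, hkmin⟩, ?_⟩
  · have h1 := hkmin z hz
    rw [mem_closedBall] at hy ⊢
    have h2 := dist_triangle y c z
    rw [dist_comm z c] at h1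
    linarith
  · rw [dist_comm]
    apply le_antisymm (infDist_le_dist_of_mem hkK)
    rw [le_infDist ⟨k, hkK⟩]
    intro y hy
    rw [dist_comm c y, dist_comm c k]
    exact hkmin y hy

/-- If `K` has no nontrivial proximal normal realised inside the preconnected open set `Ω`,
then `K` is all of `Ω`. -/
theorem IsLocallyCompactIn.eq_of_forall_isProximalCenter (hK : IsLocallyCompactIn Ω K)
    (hΩ : IsOpen Ω) (hconn : IsPreconnected Ω) (hKΩ : K ⊆ Ω) (hne : K.Nonempty)
    (h : ∀ z c, IsProximalCenter Ω K z c → c = z) : K = Ω := by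
  have hKo : IsOpen K := by
    refine isOpen_iff_mem_nhds.2 fun z hz => ?_
    obtain ⟨r, hr, hrΩ⟩ := nhds_basis_closedBall.mem_iff.1 (hΩ.mem_nhds (hKΩ hz))
    refine mem_of_superset (closedBall_mem_nhds z (half_pos hr)) fun c hc => ?_
    obtain ⟨k, -, hk, -⟩ := hK.exists_isProximalCenter hz (by simpa [mul_div_cancel₀]) hc
    rw [h k c hk]
    exact hk.1
  have hKc : IsOpen (Ω \ K) := by
    refine isOpen_iff_mem_nhds.2 fun z hz => ?_
    obtain ⟨r, hr, hrΩ⟩ := nhds_basis_closedBall.mem_iff.1 (hΩ.mem_nhds hz.1)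
    filter_upwards [closedBall_mem_nhds z hr,
      (hK z r hrΩ).isClosed.isOpen_compl.mem_nhds fun h => hz.2 h.1] with y hy hyK
    exact ⟨hrΩ hy, fun h => hyK ⟨h, hy⟩⟩
  refine hKΩ.antisymm (hconn.subset_left_of_subset_union hKo hKc disjoint_sdiff_right
    (by rw [union_sdiff_self]; exact subset_union_right) ?_)
  rwa [inter_eq_right.2 hKΩ]

variable [InnerProductSpace ℝ E] {X Y : E → E} {p q : E} {b : ℝ → E}

/-- The field `X` is orthogonal to all proximal normals to `K` realised inside `Ω`. -/
def IsTangentField (Ω K : Set E) (X : E → E) : Prop :=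
  ∀ z c, IsProximalCenter Ω K z c → inner ℝ (X z) (c - z) = 0

theorem IsTangentField.neg (hX : IsTangentField Ω K X) : IsTangentField Ω K (-X) := by
  intro z c h
  simp [hX z c h]

/-- A curve starting in `K` which is an `ε`-approximate integral curve of a tangent field stays
close to `K`. -/
theorem IsTangentField.infDist_sq_le_gronwallBound (hX : IsTangentField Ω K X)
    (hK : IsLocallyCompactIn Ω K) {r : ℝ} (hz : z ∈ K) (hΩ : closedBall z (2 * r) ⊆ Ω)
    {L : NNReal} (hL : LipschitzOnWith L X (closedBall z (2 * r))) {γ γ' : ℝ → E} {ε T : ℝ}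
    (hγ : ∀ s, HasDerivAt γ (γ' s) s) (hT : 0 ≤ T) (h0 : γ 0 ∈ K)
    (hγz : ∀ s ∈ Icc 0 T, dist (γ s) z ≤ r) (hε : ∀ s ∈ Icc 0 T, ‖γ' s - X (γ s)‖ ≤ ε) :
    infDist (γ T) K ^ 2 ≤ gronwallBound 0 (2 * L + 1) (ε ^ 2) T := by
  have hcont : Continuous γ := continuous_iff_continuousAt.2 fun s => (hγ s).continuousAt
  have key := le_gronwallBound_of_liminf_deriv_right_le (f := fun s => infDist (γ s) K ^ 2)
    (f' := fun s => (2 * L + 1) * infDist (γ s) K ^ 2 + ε ^ 2) (δ := 0) (K := 2 * L + 1)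
    (ε := ε ^ 2) (a := 0) (b := T)
    (((continuous_infDist_pt K).comp hcont).pow 2).continuousOn ?_
    (by simp [infDist_zero_of_mem h0]) (fun _ _ => le_rfl) T (right_mem_Icc.2 hT)
  · simpa using key
  intro s hs ρ hρ
  have hs' : s ∈ Icc 0 T := Ico_subset_Icc_self hs
  obtain ⟨k, hkz, hk, hkd⟩ := hK.exists_isProximalCenter hz hΩ (hγz s hs')
  have hr : 0 ≤ r := dist_nonneg.trans (hγz s hs')
  have hg : HasDerivAt (fun t => ‖γ t - k‖ ^ 2) (2 * inner ℝ (γ s - k) (γ' s)) s :=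
    ((hγ s).sub_const k).norm_sq
  have hD : infDist (γ s) K = ‖γ s - k‖ := by rw [hkd, dist_comm, dist_eq_norm]
  have hlip : ‖X (γ s) - X k‖ ≤ L * ‖γ s - k‖ :=
    hL.norm_sub_le (mem_closedBall.2 ((hγz s hs').trans (by linarith))) hkz
  have hinner : inner ℝ (γ s - k) (γ' s) ≤ ‖γ s - k‖ * (ε + L * ‖γ s - k‖) := by
    have h1 : inner ℝ (γ s - k) (γ' s) = inner ℝ (γ s - k) (γ' s - X k) := by
      rw [inner_sub_right, real_inner_comm (X k), hX k _ hk, sub_zero]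
    rw [h1]
    refine (real_inner_le_norm _ _).trans (mul_le_mul_of_nonneg_left ?_ (norm_nonneg _))
    calc ‖γ' s - X k‖ = ‖(γ' s - X (γ s)) + (X (γ s) - X k)‖ := by congr 1; abel
      _ ≤ _ := (norm_add_le _ _).trans (add_le_add (hε s hs') hlip)
  have hlt : 2 * inner ℝ (γ s - k) (γ' s) < ρ := by
    refine lt_of_le_of_lt ?_ hρ
    simp only [hD]
    nlinarith [sq_nonneg (‖γ s - k‖ - ε)]
  have hslope := (hasDerivAt_iff_tendsto_slope.1 hg).mono_left
    (nhdsWithin_mono s fun t (ht : s < t) => ht.ne')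
  refine Eventually.frequently ?_
  filter_upwards [hslope.eventually_lt_const hlt, self_mem_nhdsWithin] with t ht hst
  refine lt_of_le_of_lt ?_ ht
  rw [slope_def_field, div_eq_inv_mul]
  have hst' : 0 < t - s := sub_pos.2 hst
  refine mul_le_mul_of_nonneg_left (sub_le_sub ?_ (by rw [hD])) (inv_nonneg.2 hst'.le)
  refine pow_le_pow_left₀ infDist_nonneg ?_ 2
  rw [← dist_eq_norm]
  exact infDist_le_dist_of_mem hk.1

/-- The second order Taylor polynomial of the flow of `X` started at `b`. -/
def flowTaylor (X : E → E) (t : ℝ) (b : E) : E :=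
  b + t • X b + (t ^ 2 / 2) • fderiv ℝ X b (X b)

theorem exists_norm_sub_flowTaylor_le (hX : ContDiffAt ℝ 2 X z) {U : Set E} (hU : U ∈ 𝓝 z) :
    ∃ r > 0, ∃ L : NNReal, ∃ C δ : ℝ, 0 < δ ∧ closedBall z (2 * r) ⊆ U ∧
      LipschitzOnWith L X (closedBall z (2 * r)) ∧
      ∀ b ∈ closedBall z δ, ∀ s ∈ Icc 0 δ, dist (flowTaylor X s b) z ≤ r ∧
        ‖X b + s • fderiv ℝ X b (X b) - X (flowTaylor X s b)‖ ≤ C * s ^ 2 := by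
  have hDX : ContDiffAt ℝ 1 (fderiv ℝ X) z := hX.fderiv_right (by norm_num)
  obtain ⟨L, V, hV, hL⟩ := (hX.of_le (by norm_num : (1 : WithTop ℕ∞) ≤ 2)).exists_lipschitzOnWith
  obtain ⟨L', V', hV', hL'⟩ := hDX.exists_lipschitzOnWith
  have hdiff : ∀ᶠ y in 𝓝 z, DifferentiableAt ℝ X y :=
    (hX.eventually (by simp)).mono fun y hy => hy.differentiableAt (by norm_num)
  set M := max ‖X z‖ ‖fderiv ℝ X z‖ + 1
  have hM0 : 0 < M := by positivity
  have hXM : ∀ᶠ y in 𝓝 z, ‖X y‖ < M := hX.continuousAt.norm.eventually_lt_const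
    (lt_of_le_of_lt (le_max_left _ _) (lt_add_one _))
  have hDXM : ∀ᶠ y in 𝓝 z, ‖fderiv ℝ X y‖ < M := hDX.continuousAt.norm.eventually_lt_const
    (lt_of_le_of_lt (le_max_right _ _) (lt_add_one _))
  obtain ⟨ρ, hρ, hρsub⟩ := nhds_basis_closedBall.eventually_iff.1
    (hdiff.and <| hXM.and <| hDXM.and <| (eventually_mem_set.2 hU).and <|
      (eventually_mem_set.2 hV).and (eventually_mem_set.2 hV'))
  obtain ⟨r, hr, rfl⟩ : ∃ r > 0, 2 * r = ρ := ⟨ρ / 2, by positivity, by ring⟩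
  set N := M + M ^ 2 with hN
  have hN0 : 0 < N := by positivity
  set δ := min 1 (r / (2 * (1 + N)))
  have hδ0 : 0 < δ := by positivity
  have hδr : δ * (2 * (1 + N)) ≤ r := by
    rw [← le_div_iff₀ (by positivity)]; exact min_le_right _ _
  refine ⟨r, hr, L, L' * N ^ 2 + M ^ 3, δ, hδ0, fun y hy => (hρsub hy).2.2.2.1,
    hL.mono fun y hy => (hρsub hy).2.2.2.2.1, fun b hb s hs => ?_⟩
  rw [mem_closedBall] at hb
  have hs1 : s ≤ 1 := hs.2.trans (min_le_left _ _)
  have hb2 : b ∈ closedBall z (2 * r) := mem_closedBall.2 (by nlinarith)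
  obtain ⟨-, hXb, hDXb, -, -, hbV'⟩ := hρsub hb2
  set g := fderiv ℝ X b (X b) with hg
  have hgM : ‖g‖ ≤ M ^ 2 := by
    calc ‖g‖ ≤ ‖fderiv ℝ X b‖ * ‖X b‖ := ContinuousLinearMap.le_opNorm _ _
      _ ≤ M * M := mul_le_mul hDXb.le hXb.le (norm_nonneg _) hM0.le
      _ = M ^ 2 := by ring
  have hsub : flowTaylor X s b - b = s • X b + (s ^ 2 / 2) • g := by
    simp only [flowTaylor, ← hg]; abel
  have hdist : ‖flowTaylor X s b - b‖ ≤ s * N := by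
    rw [hsub]
    refine (norm_add_le _ _).trans ?_
    rw [norm_smul, norm_smul, Real.norm_of_nonneg hs.1,
      Real.norm_of_nonneg (by positivity : 0 ≤ s ^ 2 / 2), hN, mul_add]
    have hs0 := hs.1
    gcongr
    · nlinarith [hs.1, hs1, mul_nonneg hs.1 (sub_nonneg.2 hs1)]
  have hdz : dist (flowTaylor X s b) z ≤ r := by
    refine (dist_triangle _ b _).trans ?_
    rw [dist_eq_norm]
    nlinarith [hs.1, hs.2]
  refine ⟨hdz, ?_⟩
  have htaylor : ‖X (flowTaylor X s b) - X b - fderiv ℝ X b (flowTaylor X s b - b)‖ ≤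
      (L' * (s * N)) * ‖flowTaylor X s b - b‖ := by
    refine ((convex_closedBall z (2 * r)).inter (convex_closedBall b (s * N)))
      |>.norm_image_sub_le_of_norm_fderiv_le' (𝕜 := ℝ) (fun y hy => (hρsub hy.1).1) (fun y hy => ?_)
      ⟨hb2, mem_closedBall_self (mul_nonneg hs.1 hN0.le)⟩
      ⟨mem_closedBall.2 (by linarith), by rwa [mem_closedBall, dist_eq_norm]⟩
    refine (hL'.norm_sub_le (hρsub hy.1).2.2.2.2.2 hbV').trans ?_
    rw [← dist_eq_norm]
    gcongr
    exact hy.2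
  have hDg : ‖fderiv ℝ X b g‖ ≤ M ^ 3 := by
    calc ‖fderiv ℝ X b g‖ ≤ ‖fderiv ℝ X b‖ * ‖g‖ := ContinuousLinearMap.le_opNorm _ _
      _ ≤ M * M ^ 2 := mul_le_mul hDXb.le hgM (norm_nonneg _) hM0.le
      _ = M ^ 3 := by ring
  calc ‖X b + s • g - X (flowTaylor X s b)‖
      = ‖-(X (flowTaylor X s b) - X b - fderiv ℝ X b (flowTaylor X s b - b))
          - (s ^ 2 / 2) • fderiv ℝ X b g‖ := by
        rw [hsub, map_add, map_smul, map_smul, ← hg]; congr 1; abel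
    _ ≤ (L' * (s * N)) * (s * N) + s ^ 2 / 2 * M ^ 3 := by
        refine (norm_sub_le _ _).trans ?_
        rw [norm_neg, norm_smul, Real.norm_of_nonneg (by positivity : 0 ≤ s ^ 2 / 2)]
        gcongr
        refine htaylor.trans ?_
        have := hs.1
        gcongr
    _ ≤ (L' * N ^ 2 + M ^ 3) * s ^ 2 := by
        nlinarith [mul_nonneg (sq_nonneg s) (pow_pos hM0 3).le]

theorem IsTangentField.exists_infDist_flowTaylor_sq_le (hX : IsTangentField Ω K X)
    (hK : IsLocallyCompactIn Ω K) (hXz : ContDiffAt ℝ 2 X z) (hz : z ∈ K) (hΩ : Ω ∈ 𝓝 z) :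
    ∃ C δ : ℝ, 0 < δ ∧ ∀ b ∈ K ∩ closedBall z δ, ∀ t ∈ Icc 0 δ,
      infDist (flowTaylor X t b) K ^ 2 ≤ C * t ^ 5 := by
  obtain ⟨r, hr, L, C, δ, hδ, hrΩ, hL, hC⟩ := exists_norm_sub_flowTaylor_le hXz hΩ
  refine ⟨C ^ 2 * Real.exp (2 * L + 1), min 1 δ, by positivity, fun b hb t ht => ?_⟩
  have hb' : b ∈ closedBall z δ := closedBall_subset_closedBall (min_le_right _ _) hb.2
  have ht1 : t ≤ 1 := ht.2.trans (min_le_left _ _)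
  have htδ : t ≤ δ := ht.2.trans (min_le_right _ _)
  have hC0 : 0 ≤ C := by
    have := (norm_nonneg _).trans (hC b hb' δ ⟨hδ.le, le_rfl⟩).2
    exact nonneg_of_mul_nonneg_left this (by positivity)
  have hderiv : ∀ s, HasDerivAt (fun s => flowTaylor X s b)
      (X b + s • fderiv ℝ X b (X b)) s := by
    intro s
    have h1 := ((hasDerivAt_id' s).smul_const (X b)).const_add b
    have h2 := ((hasDerivAt_pow 2 s).div_const 2).smul_const (fderiv ℝ X b (X b))
    convert! h1.add h2 using 1
    simp
  have key := hX.infDist_sq_le_gronwallBound hK hz hrΩ hL (ε := C * t ^ 2) hderiv ht.1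
    (by simpa [flowTaylor] using hb.1)
    (fun s hs => (hC b hb' s ⟨hs.1, hs.2.trans htδ⟩).1)
    (fun s hs => (hC b hb' s ⟨hs.1, hs.2.trans htδ⟩).2.trans
      (mul_le_mul_of_nonneg_left (pow_le_pow_left₀ hs.1 hs.2 2) hC0))
  refine key.trans ?_
  have hL1 : (0 : ℝ) < 2 * L + 1 := by positivity
  rw [gronwallBound_of_K_ne_0 hL1.ne']
  set k : ℝ := 2 * L + 1
  have hexp : Real.exp (k * t) - 1 ≤ k * t * Real.exp k := by
    have h1 : 1 - k * t ≤ Real.exp (-(k * t)) := by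
      have := Real.add_one_le_exp (-(k * t)); linarith
    have h2 : Real.exp (-(k * t)) * Real.exp (k * t) = 1 := by rw [← Real.exp_add]; simp
    have h3 : Real.exp (k * t) ≤ Real.exp k :=
      Real.exp_le_exp.2 (mul_le_of_le_one_right hL1.le ht1)
    have h4 : 0 ≤ k * t := mul_nonneg hL1.le ht.1
    nlinarith [Real.exp_pos (k * t)]
  calc 0 * Real.exp (k * t) + (C * t ^ 2) ^ 2 / k * (Real.exp (k * t) - 1)
      ≤ 0 * Real.exp (k * t) + (C * t ^ 2) ^ 2 / k * (k * t * Real.exp k) := by gcongr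
    _ = C ^ 2 * Real.exp k * t ^ 5 := by field_simp; ring

/-- The curve `b` equals `z + t p + t² q + o(t²)` as `t → 0⁺`. -/
def HasQuadraticExpansion (b : ℝ → E) (z p q : E) : Prop :=
  (fun t => b t - (z + t • p + t ^ 2 • q)) =o[𝓝[>] 0] fun t : ℝ => t ^ 2

theorem isBigO_smul_const {α : Type*} (l : Filter α) (f : α → ℝ) (v : E) :
    (fun t => f t • v) =O[l] f :=
  IsBigO.of_bound ‖v‖ (Eventually.of_forall fun t => by rw [norm_smul, mul_comm])

theorem isLittleO_sq_id_nhdsGT : (fun t : ℝ => t ^ 2) =o[𝓝[>] 0] fun t : ℝ => t := by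
  simpa using (isLittleO_pow_pow (𝕜 := ℝ) one_lt_two).mono nhdsWithin_le_nhds

theorem HasQuadraticExpansion.isLittleO (hb : HasQuadraticExpansion b z p q) :
    (fun t => b t - z - t • p) =o[𝓝[>] 0] fun t : ℝ => t := by
  have h1 : (fun t : ℝ => t ^ 2 • q) =o[𝓝[>] 0] fun t : ℝ => t := by
    refine IsBigO.trans_isLittleO ?_ isLittleO_sq_id_nhdsGT
    exact isBigO_smul_const _ _ q
  refine ((IsLittleO.trans hb isLittleO_sq_id_nhdsGT).add h1).congr_left fun t => ?_
  abel

theorem HasQuadraticExpansion.isBigO (hb : HasQuadraticExpansion b z p q) :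
    (fun t => b t - z) =O[𝓝[>] 0] fun t : ℝ => t := by
  have h1 : (fun t : ℝ => t • p) =O[𝓝[>] 0] fun t : ℝ => t :=
    isBigO_smul_const _ _ p
  refine (hb.isLittleO.isBigO.add h1).congr_left fun t => ?_
  abel

theorem HasQuadraticExpansion.tendsto (hb : HasQuadraticExpansion b z p q) :
    Tendsto b (𝓝[>] 0) (𝓝 z) := by
  have h := hb.isBigO.trans_tendsto (tendsto_nhdsWithin_of_tendsto_nhds tendsto_id)
  simpa using h.add_const z

theorem HasQuadraticExpansion.flowTaylor (hb : HasQuadraticExpansion b z p q)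
    (hX : ContDiffAt ℝ 2 X z) :
    HasQuadraticExpansion (fun t => flowTaylor X t (b t)) z (p + X z)
      (q + fderiv ℝ X z p + (2⁻¹ : ℝ) • fderiv ℝ X z (X z)) := by
  have hXd : HasFDerivAt X (fderiv ℝ X z) z := (hX.differentiableAt (by norm_num)).hasFDerivAt
  have h1 : (fun t => X (b t) - X z - t • fderiv ℝ X z p) =o[𝓝[>] 0] fun t : ℝ => t := by
    have h2 : (fun t => X (b t) - X z - fderiv ℝ X z (b t - z)) =o[𝓝[>] 0] fun t : ℝ => t :=
      (hXd.isLittleO.comp_tendsto hb.tendsto).trans_isBigO hb.isBigO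
    have h3 : (fun t => fderiv ℝ X z (b t - z - t • p)) =o[𝓝[>] 0] fun t : ℝ => t :=
      ((fderiv ℝ X z).isBigO_comp _ _).trans_isLittleO hb.isLittleO
    refine (h2.add h3).congr_left fun t => ?_
    simp only [map_sub, map_smul]; abel
  have h4 : (fun t => fderiv ℝ X (b t) (X (b t)) - fderiv ℝ X z (X z)) =o[𝓝[>] 0]
      fun _ : ℝ => (1 : ℝ) := by
    rw [isLittleO_one_iff, tendsto_sub_nhds_zero_iff]
    have hc : ContinuousAt (fun y => fderiv ℝ X y (X y)) z :=
      (hX.continuousAt_fderiv (by norm_num)).clm_apply hX.continuousAt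
    exact hc.tendsto.comp hb.tendsto
  have h5 : (fun t : ℝ => t • (X (b t) - X z - t • fderiv ℝ X z p)) =o[𝓝[>] 0]
      fun t : ℝ => t ^ 2 := by
    simpa [sq] using (isBigO_refl (fun t : ℝ => t) (𝓝[>] 0)).smul_isLittleO h1
  have h6 : (fun t : ℝ => (t ^ 2 / 2) • (fderiv ℝ X (b t) (X (b t)) - fderiv ℝ X z (X z)))
      =o[𝓝[>] 0] fun t : ℝ => t ^ 2 := by
    have h7 : (fun t : ℝ => t ^ 2 / 2) =O[𝓝[>] 0] fun t : ℝ => t ^ 2 := by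
      simpa [div_eq_inv_mul] using (isBigO_refl (fun t : ℝ => t ^ 2) (𝓝[>] 0)).const_mul_left 2⁻¹
    simpa using h7.smul_isLittleO h4
  refine ((IsLittleO.add hb h5).add h6).congr_left fun t => ?_
  simp only [_root_.flowTaylor]
  module

theorem HasQuadraticExpansion.exists_of_isTangentField (hb : HasQuadraticExpansion b z p q)
    (hbK : ∀ᶠ t in 𝓝[>] 0, b t ∈ K) (hX : IsTangentField Ω K X)
    (hK : IsLocallyCompactIn Ω K) (hXz : ContDiffAt ℝ 2 X z) (hz : z ∈ K) (hΩ : Ω ∈ 𝓝 z) :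
    ∃ b' : ℝ → E, (∀ᶠ t in 𝓝[>] 0, b' t ∈ K) ∧ HasQuadraticExpansion b' z (p + X z)
      (q + fderiv ℝ X z p + (2⁻¹ : ℝ) • fderiv ℝ X z (X z)) := by
  obtain ⟨r, hr, hrΩ⟩ := nhds_basis_closedBall.mem_iff.1 hΩ
  obtain ⟨C, δ, hδ, hC⟩ := hX.exists_infDist_flowTaylor_sq_le hK hXz hz hΩ
  have hφ := hb.flowTaylor hXz
  have hnear : ∀ c : E, ∃ k : E, dist c z ≤ r / 2 → k ∈ K ∧ infDist c K = dist k c := by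
    intro c
    by_cases hc : dist c z ≤ r / 2
    · obtain ⟨k, -, hk, hkd⟩ := hK.exists_isProximalCenter hz (by simpa [mul_div_cancel₀]) hc
      exact ⟨k, fun _ => ⟨hk.1, hkd⟩⟩
    · exact ⟨c, fun h => absurd h hc⟩
  choose k hk using hnear
  have hφr : ∀ᶠ t in 𝓝[>] 0, dist (_root_.flowTaylor X t (b t)) z ≤ r / 2 :=
    hφ.tendsto.eventually (closedBall_mem_nhds z (half_pos hr))
  refine ⟨fun t => k (_root_.flowTaylor X t (b t)), hφr.mono fun t ht => (hk _ ht).1, ?_⟩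
  have hdiff : (fun t => k (_root_.flowTaylor X t (b t)) - _root_.flowTaylor X t (b t))
      =o[𝓝[>] 0] fun t : ℝ => t ^ 2 := by
    rw [isLittleO_iff]
    intro ε hε
    have hsmall : ∀ᶠ t in 𝓝[>] (0 : ℝ), C * t < ε ^ 2 :=
      (tendsto_nhdsWithin_of_tendsto_nhds ((continuous_const_mul C).tendsto' 0 0 (by simp)))
        |>.eventually_lt_const (by positivity)
    filter_upwards [hφr, hsmall, self_mem_nhdsWithin, hbK,
      hb.tendsto.eventually (closedBall_mem_nhds z hδ),
      nhdsWithin_le_nhds (Iic_mem_nhds hδ)] with t ht1 ht2 ht3 ht4 ht5 ht6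
    have ht3' : 0 < t := ht3
    rw [← dist_eq_norm, ← (hk _ ht1).2, Real.norm_of_nonneg (sq_nonneg t)]
    refine le_of_sq_le_sq ?_ (by positivity)
    calc _ ≤ C * t ^ 5 := hC _ ⟨ht4, ht5⟩ t ⟨ht3'.le, ht6⟩
      _ = C * t * t ^ 4 := by ring
      _ ≤ ε ^ 2 * t ^ 4 := by gcongr
      _ = (ε * t ^ 2) ^ 2 := by ring
  refine (IsLittleO.add hdiff hφ).congr_left fun t => ?_
  abel

theorem HasQuadraticExpansion.inner_nonpos {c w : E} (hb : HasQuadraticExpansion b z 0 w)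
    (hbK : ∀ᶠ t in 𝓝[>] 0, b t ∈ K) (hc : IsProximalCenter Ω K z c) :
    inner ℝ w (c - z) ≤ 0 := by
  have hsq : (fun t => b t - z) =O[𝓝[>] 0] fun t : ℝ => t ^ 2 := by
    have h1 : (fun t : ℝ => t ^ 2 • w) =O[𝓝[>] 0] fun t : ℝ => t ^ 2 :=
      isBigO_smul_const _ _ w
    refine ((IsLittleO.isBigO hb).add h1).congr_left fun t => ?_
    rw [smul_zero]; abel
  have hlim : Tendsto (fun t : ℝ => (t ^ 2)⁻¹ • (b t - z)) (𝓝[>] 0) (𝓝 w) := by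
    have h1 := hb.tendsto_inv_smul_nhds_zero
    have h2 := h1.add_const w
    rw [zero_add] at h2
    refine h2.congr' ?_
    filter_upwards [self_mem_nhdsWithin] with t ht
    have ht' : t ≠ 0 := (show 0 < t from ht).ne'
    rw [smul_zero, add_zero, sub_add_eq_sub_sub, smul_sub, smul_smul,
      inv_mul_cancel₀ (pow_ne_zero 2 ht'), one_smul, sub_add_cancel]
  have hlim0 : Tendsto (fun t => b t - z) (𝓝[>] 0) (𝓝 0) := by
    simpa using hb.tendsto.sub_const z
  have hlim2 : Tendsto (fun t : ℝ => 2 * inner ℝ ((t ^ 2)⁻¹ • (b t - z)) (c - z)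
      - inner ℝ ((t ^ 2)⁻¹ • (b t - z)) (b t - z)) (𝓝[>] 0) (𝓝 (2 * inner ℝ w (c - z) - 0)) := by
    refine ((hlim.inner tendsto_const_nhds).const_mul 2).sub ?_
    simpa using hlim.inner hlim0
  have hle : ∀ᶠ t : ℝ in 𝓝[>] 0, 2 * inner ℝ ((t ^ 2)⁻¹ • (b t - z)) (c - z)
      - inner ℝ ((t ^ 2)⁻¹ • (b t - z)) (b t - z) ≤ 0 := by
    filter_upwards [hbK] with t ht
    have h1 := hc.2.2 _ ht
    rw [dist_comm z, dist_comm (b t), dist_eq_norm, dist_eq_norm] at h1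
    have h2 : ‖c - b t‖ ^ 2 = ‖c - z‖ ^ 2 - 2 * inner ℝ (b t - z) (c - z) + ‖b t - z‖ ^ 2 := by
      rw [real_inner_comm, ← norm_sub_sq_real]; congr 2; abel
    have h3 : ‖c - z‖ ^ 2 ≤ ‖c - b t‖ ^ 2 := by gcongr
    rw [real_inner_smul_left, real_inner_smul_left, real_inner_self_eq_norm_sq]
    have h4 : 0 ≤ (t ^ 2)⁻¹ := by positivity
    nlinarith
  have := le_of_tendsto hlim2 hle
  linarith

theorem IsTangentField.inner_bracket_nonpos (hX : IsTangentField Ω K X)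
    (hY : IsTangentField Ω K Y) (hK : IsLocallyCompactIn Ω K) {c : E}
    (hc : IsProximalCenter Ω K z c) (hΩ : Ω ∈ 𝓝 z) (hXz : ContDiffAt ℝ 2 X z)
    (hYz : ContDiffAt ℝ 2 Y z) :
    inner ℝ (fderiv ℝ Y z (X z) - fderiv ℝ X z (Y z)) (c - z) ≤ 0 := by
  have h0 : HasQuadraticExpansion (fun _ => z) z 0 0 := by
    simp [HasQuadraticExpansion]
  obtain ⟨b₁, hb₁, h₁⟩ := h0.exists_of_isTangentField (Eventually.of_forall fun _ => hc.1)
    hX hK hXz hc.1 hΩ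
  obtain ⟨b₂, hb₂, h₂⟩ := h₁.exists_of_isTangentField hb₁ hY hK hYz hc.1 hΩ
  obtain ⟨b₃, hb₃, h₃⟩ := h₂.exists_of_isTangentField hb₂ hX.neg hK hXz.neg hc.1 hΩ
  obtain ⟨b₄, hb₄, h₄⟩ := h₃.exists_of_isTangentField hb₃ hY.neg hK hYz.neg hc.1 hΩ
  refine HasQuadraticExpansion.inner_nonpos (b := b₄) ?_ hb₄ hc
  have hnX : fderiv ℝ (-X) z = -fderiv ℝ X z := fderiv_neg
  have hnY : fderiv ℝ (-Y) z = -fderiv ℝ Y z := fderiv_neg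
  convert h₄ using 1
  · simp
  · simp only [hnX, hnY, Pi.neg_apply, neg_apply, map_add, map_neg, map_zero]
    module

theorem IsTangentField.bracket (hX : IsTangentField Ω K X) (hY : IsTangentField Ω K Y)
    (hK : IsLocallyCompactIn Ω K) (hΩ : IsOpen Ω) (hKΩ : K ⊆ Ω) (hXd : ContDiffOn ℝ 2 X Ω)
    (hYd : ContDiffOn ℝ 2 Y Ω) :
    IsTangentField Ω K fun x => fderiv ℝ Y x (X x) - fderiv ℝ X x (Y x) := by
  intro z c hc
  have hz : Ω ∈ 𝓝 z := hΩ.mem_nhds (hKΩ hc.1)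
  apply le_antisymm
  · exact hX.inner_bracket_nonpos hY hK hc hz (hXd.contDiffAt hz) (hYd.contDiffAt hz)
  · have h := hY.inner_bracket_nonpos hX hK hc hz (hYd.contDiffAt hz) (hXd.contDiffAt hz)
    rw [← neg_sub, inner_neg_left] at h
    linarith

end Invariance

section Barrier

variable {d : ℕ}

/-- The barrier `exp (-γ |x - c|²) - exp (-γ R²)`, positive exactly in the ball of radius `R`
about `c`. -/
def expBarrier (γ R : ℝ) (c x : EV d) : ℝ :=
  Real.exp (-(γ * ‖x - c‖ ^ 2)) - Real.exp (-(γ * R ^ 2))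

variable (γ R ε : ℝ) (c x : EV d)

theorem contDiff_expBarrier {n : WithTop ℕ∞} : ContDiff ℝ n (expBarrier γ R c) :=
  ((contDiff_const.mul ((contDiff_id.sub contDiff_const).norm_sq ℝ)).neg.exp).sub contDiff_const

theorem hasFDerivAt_exp_neg_mul_norm_sq :
    HasFDerivAt (fun x : EV d => Real.exp (-(γ * ‖x - c‖ ^ 2)))
      ((-(2 * γ * Real.exp (-(γ * ‖x - c‖ ^ 2)))) • innerSL ℝ (x - c)) x := by
  have h := ((((hasFDerivAt_id x).sub_const c).norm_sq).const_mul γ).neg.exp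
  convert! h using 1
  ext y
  simp
  ring

theorem fderiv_neg_mul_expBarrier (j : Fin d) :
    fderiv ℝ (fun y => -(ε * expBarrier γ R c y)) x (EuclideanSpace.single j 1) =
      2 * γ * ε * (Real.exp (-(γ * ‖x - c‖ ^ 2)) * (x j - c j)) := by
  have h : HasFDerivAt (fun y => -(ε * expBarrier γ R c y)) _ x :=
    (((hasFDerivAt_exp_neg_mul_norm_sq γ c x).sub_const
      (Real.exp (-(γ * R ^ 2)))).const_mul ε).neg
  rw [h.fderiv]
  simp [EuclideanSpace.inner_single_right]
  ring

theorem grad_neg_mul_expBarrier :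
    grad (fun y => -(ε * expBarrier γ R c y)) x =
      ε • (2 * γ * Real.exp (-(γ * ‖x - c‖ ^ 2))) • (x - c) := by
  ext j
  simp only [grad, fderiv_neg_mul_expBarrier]
  simp
  ring

theorem hess_neg_mul_expBarrier :
    hess (fun y => -(ε * expBarrier γ R c y)) x =
      ε • (2 * γ * Real.exp (-(γ * ‖x - c‖ ^ 2))) •
        (1 - (2 * γ) • outer (x - c) : Matrix (Fin d) (Fin d) ℝ) := by
  ext i j
  simp only [hess, fderiv_neg_mul_expBarrier]
  have hj : HasFDerivAt (fun y : EV d => y j - c j)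
      (EuclideanSpace.proj j : EV d →L[ℝ] ℝ) x :=
    (EuclideanSpace.proj j : EV d →L[ℝ] ℝ).hasFDerivAt.sub_const _
  have h : HasFDerivAt (fun y : EV d => 2 * γ * ε *
      (Real.exp (-(γ * ‖y - c‖ ^ 2)) * (y j - c j))) _ x :=
    ((hasFDerivAt_exp_neg_mul_norm_sq γ c x).mul hj).const_mul (2 * γ * ε)
  rw [Matrix.of_apply, h.fderiv]
  by_cases hij : i = j
  · subst hij
    simp [outer, EuclideanSpace.inner_single_right]
    ring
  · simp [outer, hij, Ne.symm hij, EuclideanSpace.inner_single_right]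
    ring

theorem isSymm_one_sub_smul_outer (p : EV d) : (1 - γ • outer p).IsSymm := by
  refine Matrix.IsSymm.sub Matrix.isSymm_one (Matrix.IsSymm.smul ?_ _)
  ext i j
  simp [outer, mul_comm]

theorem posSemidef_outer (p : EV d) : (outer p).PosSemidef := by
  convert Matrix.posSemidef_vecMulVec_self_star (R := ℝ) (fun i => p i) using 1
  ext i j
  simp [outer, Matrix.vecMulVec_apply]

end Barrier

section Propagation

variable {d m : ℕ} {Ω : Set (EV d)} {F : EV d → ℝ → EV d → Matrix (Fin d) (Fin d) ℝ → ℝ}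
  {u : EV d → ℝ} {M : ℝ}

theorem inner_eq_dotp (p q : EV d) : inner ℝ p q = dotp p q := by
  simp [dotp, PiLp.inner_apply, mul_comm]

theorem exists_two_mul_mul_exp_le_one (γ₀ : ℝ) {R : ℝ} (hR : 0 < R) :
    ∃ γ : ℝ, 0 < γ ∧ γ₀ ≤ 2 * γ ∧ 2 * γ * Real.exp (-(γ * R ^ 2)) ≤ 1 := by
  have h1 : Tendsto (fun γ : ℝ => γ * Real.exp (-(R ^ 2) * γ)) atTop (𝓝 0) := by
    simpa using tendsto_rpow_mul_exp_neg_mul_atTop_nhds_zero 1 (R ^ 2) (by positivity)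
  obtain ⟨γ, h2, h3, h4⟩ := ((h1.eventually_lt_const (by norm_num : (0 : ℝ) < 1 / 2)).and
    ((eventually_gt_atTop 0).and (eventually_ge_atTop (γ₀ / 2)))).exists
  refine ⟨γ, h3, by linarith, ?_⟩
  rw [show -(γ * R ^ 2) = -(R ^ 2) * γ by ring]
  linarith

/-- Near a point where the gradient of the barrier is not orthogonal to a subunit vector, the
negative of a steep enough barrier is a strict supersolution. -/
theorem exists_eventually_pos_expBarrier (hΩ : IsOpen Ω) (hFlsc : IsLscOperator Ω F)
    (hFprop : IsProper Ω F) (hFscal : HasScaling Ω F) {z c : EV d} (hz : z ∈ Ω) {Z : EV d}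
    (hZ : IsSubunitAt F z Z) (hZc : dotp Z (z - c) ≠ 0) :
    ∃ γ > 0, ∀ᶠ y in 𝓝 z, 0 < F y (-expBarrier γ (dist z c) c y)
      (grad (fun y => -(1 * expBarrier γ (dist z c) c y)) y)
      (hess (fun y => -(1 * expBarrier γ (dist z c) c y)) y) := by
  have hzc : z - c ≠ 0 := by
    intro h
    simp [h, dotp] at hZc
  have hR : 0 < dist z c := by rwa [dist_eq_norm, norm_pos_iff]
  obtain ⟨γ₀, -, hγ₀⟩ := hZ _ hZc
  obtain ⟨γ, hγ, hγγ₀, hexp⟩ := exists_two_mul_mul_exp_le_one γ₀ hR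
  obtain ⟨φ, hφ, hscal⟩ := hFscal
  refine ⟨γ, hγ, ?_⟩
  simp only [grad_neg_mul_expBarrier, hess_neg_mul_expBarrier, one_smul]
  have hpos : 0 < F z (-expBarrier γ (dist z c) c z)
      ((2 * γ * Real.exp (-(γ * ‖z - c‖ ^ 2))) • (z - c))
      ((2 * γ * Real.exp (-(γ * ‖z - c‖ ^ 2))) • (1 - (2 * γ) • outer (z - c))) := by
    rw [← dist_eq_norm]
    have hξ : 2 * γ * Real.exp (-(γ * dist z c ^ 2)) ∈ Ioc (0 : ℝ) 1 := ⟨by positivity, hexp⟩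
    have h1 := hscal _ hξ 0 (by simp) z hz _ hzc _ (isSymm_one_sub_smul_outer (2 * γ) (z - c))
    have h2 : F z 0 (z - c) (1 - γ₀ • outer (z - c)) ≤
        F z 0 (z - c) (1 - (2 * γ) • outer (z - c)) := by
      refine hFprop z hz _ _ _ _ _ le_rfl ?_
      rw [sub_sub_sub_cancel_left, ← sub_smul]
      exact (posSemidef_outer _).smul (by linarith)
    have h3 : expBarrier γ (dist z c) c z = 0 := by simp [expBarrier, dist_eq_norm]
    rw [mul_zero] at h1
    rw [h3, neg_zero]
    exact (mul_pos (hφ _ hξ) (hγ₀.trans_le h2)).trans_le h1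
  have hcv : Continuous (expBarrier γ (dist z c) c) :=
    (contDiff_expBarrier γ (dist z c) c (n := 0)).continuous
  have hcs : Continuous fun y : EV d => 2 * γ * Real.exp (-(γ * ‖y - c‖ ^ 2)) := by fun_prop
  have hco : Continuous fun y : EV d => outer (y - c) :=
    continuous_matrix fun i j => by simp only [outer, Matrix.of_apply]; fun_prop
  have hcont : Continuous fun y : EV d => (y, -expBarrier γ (dist z c) c y,
      (2 * γ * Real.exp (-(γ * ‖y - c‖ ^ 2))) • (y - c),
      (2 * γ * Real.exp (-(γ * ‖y - c‖ ^ 2))) •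
        (1 - (2 * γ) • outer (y - c) : Matrix (Fin d) (Fin d) ℝ)) :=
    continuous_id.prodMk (hcv.neg.prodMk ((hcs.smul (continuous_id.sub continuous_const)).prodMk
      (hcs.smul (continuous_const.sub (hco.const_smul (2 * γ))))))
  have hmem : ∀ y ∈ Ω, y ≠ c → (y, -expBarrier γ (dist z c) c y,
      (2 * γ * Real.exp (-(γ * ‖y - c‖ ^ 2))) • (y - c),
      (2 * γ * Real.exp (-(γ * ‖y - c‖ ^ 2))) •
        (1 - (2 * γ) • outer (y - c) : Matrix (Fin d) (Fin d) ℝ)) ∈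
      {q : EV d × ℝ × EV d × Matrix (Fin d) (Fin d) ℝ | q.1 ∈ Ω ∧ q.2.2.1 ≠ 0 ∧ q.2.2.2.IsSymm} :=
    fun y hy hyc => ⟨hy, smul_ne_zero (by positivity) (sub_ne_zero.2 hyc),
      (isSymm_one_sub_smul_outer _ _).smul _⟩
  have hlsc := hFlsc _ (hmem z hz (sub_ne_zero.1 hzc)) 0 hpos
  refine (tendsto_nhdsWithin_iff.2 ⟨hcont.tendsto z, ?_⟩).eventually hlsc
  filter_upwards [hΩ.mem_nhds hz, isOpen_ne.mem_nhds (sub_ne_zero.1 hzc)] with y hy hyc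
  exact hmem y hy hyc

theorem IsCompact.exists_pos_forall_add_mul_lt {S : Set (EV d)} (hS : IsCompact S)
    (husc : UpperSemicontinuousOn u S) (hu : ∀ y ∈ S, u y < M) {v : EV d → ℝ}
    (hv : ∀ y, v y ≤ 1) : ∃ ε ∈ Ioc (0 : ℝ) 1, ∀ y ∈ S, u y + ε * v y < M := by
  rcases S.eq_empty_or_nonempty with rfl | hne
  · exact ⟨1, by simp, by simp⟩
  obtain ⟨a, ha, hmax⟩ := husc.exists_isMaxOn hne hS
  have haM : 0 < M - u a := sub_pos.2 (hu a ha)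
  refine ⟨min 1 ((M - u a) / 2), ⟨by positivity, min_le_left _ _⟩, fun y hy => ?_⟩
  have h1 : min 1 ((M - u a) / 2) * v y ≤ min 1 ((M - u a) / 2) :=
    mul_le_of_le_one_right (by positivity) (hv y)
  have h2 := min_le_right 1 ((M - u a) / 2)
  have h3 : u y ≤ u a := hmax hy
  linarith

/-- Hopf-type lemma: a subsolution attaining a nonnegative maximum at `z`, and below it on the rest
of a closed ball through `z`, has all subunit vectors at `z` tangent to that ball. -/
theorem IsViscSubsol.dotp_eq_zero_of_isSubunitAt (hΩ : IsOpen Ω) (hFlsc : IsLscOperator Ω F)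
    (hFprop : IsProper Ω F) (hFscal : HasScaling Ω F) (husc : UpperSemicontinuousOn u Ω)
    (hsub : IsViscSubsol Ω F u) (hM : 0 ≤ M) (hmax : ∀ x ∈ Ω, u x ≤ M) {z c : EV d}
    (hz : z ∈ Ω) (huz : u z = M) (hlt : ∀ y ∈ Ω, y ∈ closedBall c (dist z c) → y ≠ z → u y < M)
    {Z : EV d} (hZ : IsSubunitAt F z Z) : dotp Z (z - c) = 0 := by
  by_contra hZc
  obtain ⟨γ, hγ, hpos⟩ :=
    exists_eventually_pos_expBarrier hΩ hFlsc hFprop hFscal hz hZ hZc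
  obtain ⟨φ, hφ, hscal⟩ := hFscal
  have hzc : z ≠ c := by
    rintro rfl
    simp [dotp] at hZc
  set v := expBarrier γ (dist z c) c with hv
  have hvz : v z = 0 := by simp [hv, expBarrier, dist_eq_norm]
  have hv1 : ∀ y, v y ≤ 1 := by
    intro y
    have h1 : Real.exp (-(γ * ‖y - c‖ ^ 2)) ≤ 1 := Real.exp_le_one_iff.2 (by
      have : 0 ≤ γ * ‖y - c‖ ^ 2 := by positivity
      linarith)
    have h2 := Real.exp_pos (-(γ * dist z c ^ 2))
    simp only [hv, expBarrier]
    linarith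
  have hvneg : ∀ y, y ∉ closedBall c (dist z c) → v y < 0 := by
    intro y hy
    rw [mem_closedBall, not_le, dist_eq_norm y] at hy
    simp only [hv, expBarrier, sub_neg, Real.exp_lt_exp, neg_lt_neg_iff]
    gcongr
  have hvcont : Continuous v := (contDiff_expBarrier γ (dist z c) c (n := 0)).continuous
  obtain ⟨ρ, hρ, hρsub⟩ := nhds_basis_closedBall.eventually_iff.1
    (hpos.and ((hΩ.eventually_mem hz).and (isOpen_ne.eventually_mem hzc)))
  have hρΩ : closedBall z ρ ⊆ Ω := fun y hy => (hρsub hy).2.1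
  obtain ⟨ε, hε, hεlt⟩ := ((isCompact_sphere z ρ).inter_right
    (isClosed_closedBall (x := c) (ε := dist z c))).exists_pos_forall_add_mul_lt (u := u) (M := M)
    (husc.mono fun y hy => hρΩ (sphere_subset_closedBall hy.1))
    (fun y hy => hlt y (hρΩ (sphere_subset_closedBall hy.1)) hy.2
      (ne_of_mem_sphere hy.1 hρ.ne')) hv1
  have hεv : Continuous fun y => ε * v y := hvcont.const_mul ε
  obtain ⟨y, hy, hymax⟩ := UpperSemicontinuousOn.exists_isMaxOn (f := fun y => u y + ε * v y)
    ⟨z, mem_closedBall_self hρ.le⟩ (isCompact_closedBall z ρ)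
    ((husc.mono hρΩ).add (hεv.upperSemicontinuous.upperSemicontinuousOn _))
  have hyM : M ≤ u y + ε * v y := by
    have h1 : u z + ε * v z ≤ u y + ε * v y := hymax (mem_closedBall_self hρ.le)
    rwa [hvz, mul_zero, add_zero, huz] at h1
  have hyΩ := hρΩ hy
  have hvy : 0 ≤ v y := by
    have h1 := hmax y hyΩ
    exact nonneg_of_mul_nonneg_right (by linarith) hε.1
  have hyball : y ∈ ball z ρ := by
    by_contra hyb
    have hys : y ∈ sphere z ρ := le_antisymm hy (not_lt.1 hyb)
    by_cases hyc : y ∈ closedBall c (dist z c)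
    · exact (hεlt y ⟨hys, hyc⟩).not_ge hyM
    · exact (hvneg y hyc).not_ge hvy
  obtain ⟨hypos, -, hyc⟩ := hρsub hy
  have hloc : IsLocalMaxOn (fun x => u x - -(ε * v x)) Ω y := by
    refine Filter.Eventually.filter_mono nhdsWithin_le_nhds ?_
    filter_upwards [isOpen_ball.mem_nhds hyball] with x hx
    simpa using hymax (ball_subset_closedBall hx)
  have hp : (2 * γ * Real.exp (-(γ * ‖y - c‖ ^ 2))) • (y - c) ≠ 0 :=
    smul_ne_zero (by positivity) (sub_ne_zero.2 hyc)
  have hle := hsub (fun x => -(ε * v x))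
    (contDiff_const.mul (contDiff_expBarrier γ (dist z c) c)).neg y hyΩ hloc (by
      rw [grad_neg_mul_expBarrier]; exact smul_ne_zero hε.1.ne' hp)
  rw [grad_neg_mul_expBarrier, hess_neg_mul_expBarrier] at hle hypos
  rw [one_smul, one_smul] at hypos
  have hprop := hFprop y hyΩ (ε * -v y) (u y)
    (ε • (2 * γ * Real.exp (-(γ * ‖y - c‖ ^ 2))) • (y - c))
    (ε • (2 * γ * Real.exp (-(γ * ‖y - c‖ ^ 2))) • (1 - (2 * γ) • outer (y - c))) _
    (by linarith) (by rw [sub_self]; exact Matrix.PosSemidef.zero)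
  have hs := hscal ε hε (-v y) ⟨by linarith [hv1 y], by linarith⟩ y hyΩ _ hp _
    ((isSymm_one_sub_smul_outer (2 * γ) (y - c)).smul (2 * γ * Real.exp (-(γ * ‖y - c‖ ^ 2))))
  have := mul_pos (hφ ε hε) hypos
  linarith

theorem dist_midpoint_lt_of_ne {z c y : EV d} (hyz : y ≠ z)
    (hy : y ∈ closedBall (midpoint ℝ z c) (dist z (midpoint ℝ z c))) : dist y c < dist z c := by
  have hm : z - midpoint ℝ z c = (2⁻¹ : ℝ) • (z - c) := by
    rw [left_sub_midpoint]; simp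
  have hc : y - c = (y - z) + (2 : ℝ) • (z - midpoint ℝ z c) := by
    rw [hm, smul_smul]; norm_num
  have hz : z - c = (2 : ℝ) • (z - midpoint ℝ z c) := by
    rw [hm, smul_smul]; norm_num
  rw [mem_closedBall, dist_eq_norm, dist_eq_norm, ← sub_add_sub_cancel y z] at hy
  rw [dist_eq_norm, dist_eq_norm]
  refine lt_of_pow_lt_pow_left₀ 2 (norm_nonneg _) ?_
  have h1 := pow_le_pow_left₀ (norm_nonneg _) hy 2
  have h2 : 0 < ‖y - z‖ := norm_pos_iff.2 (sub_ne_zero.2 hyz)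
  rw [norm_add_sq_real] at h1
  rw [hc, hz, norm_add_sq_real, inner_smul_right]
  nlinarith [pow_pos h2 2]

/-- Subunit vector fields are tangent to the maximum set of a subsolution. -/
theorem IsViscSubsol.isTangentField_of_isSubunitAt (hΩ : IsOpen Ω) (hFlsc : IsLscOperator Ω F)
    (hFprop : IsProper Ω F) (hFscal : HasScaling Ω F) (husc : UpperSemicontinuousOn u Ω)
    (hsub : IsViscSubsol Ω F u) (hM : 0 ≤ M) (hmax : ∀ x ∈ Ω, u x ≤ M) {Z : EV d → EV d}
    (hZ : ∀ x ∈ Ω, IsSubunitAt F x (Z x)) : IsTangentField Ω {x ∈ Ω | u x = M} Z := by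
  rintro z c ⟨⟨hz, huz⟩, -, hmin⟩
  have h := hsub.dotp_eq_zero_of_isSubunitAt hΩ hFlsc hFprop hFscal husc hM hmax hz huz
    (c := midpoint ℝ z c) (fun y hyΩ hy hyz => lt_of_le_of_ne (hmax y hyΩ) fun huy =>
      (dist_midpoint_lt_of_ne hyz hy).not_ge (hmin y ⟨hyΩ, huy⟩)) (hZ z hz)
  rw [← inner_eq_dotp, left_sub_midpoint, inner_smul_right] at h
  rw [← neg_sub, inner_neg_right, neg_eq_zero]
  simpa using h

theorem LieGenerated.contDiffOn {Z : Fin m → EV d → EV d} (hΩ : IsOpen Ω)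
    (hZ : ∀ i, ContDiffOn ℝ (⊤ : ℕ∞) (Z i) Ω) {W : EV d → EV d} (hW : LieGenerated Z W) :
    ContDiffOn ℝ (⊤ : ℕ∞) W Ω := by
  induction hW with
  | base i => exact hZ i
  | bracket _ _ hX hY =>
    exact ((hY.fderiv_of_isOpen hΩ (by simp)).clm_apply hX).sub
      ((hX.fderiv_of_isOpen hΩ (by simp)).clm_apply hY)

theorem LieGenerated.isTangentField {Z : Fin m → EV d → EV d} {K : Set (EV d)} (hΩ : IsOpen Ω)
    (hZ : ∀ i, ContDiffOn ℝ (⊤ : ℕ∞) (Z i) Ω) (hK : IsLocallyCompactIn Ω K) (hKΩ : K ⊆ Ω)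
    (hZK : ∀ i, IsTangentField Ω K (Z i)) {W : EV d → EV d} (hW : LieGenerated Z W) :
    IsTangentField Ω K W := by
  induction hW with
  | base i => exact hZK i
  | bracket hX hY hXK hYK =>
    exact hXK.bracket hYK hK hΩ hKΩ ((hX.contDiffOn hΩ hZ).of_le (WithTop.coe_le_coe.2 le_top))
      ((hY.contDiffOn hΩ hZ).of_le (WithTop.coe_le_coe.2 le_top))

theorem isLocallyCompactIn_maxSet (husc : UpperSemicontinuousOn u Ω) (hmax : ∀ x ∈ Ω, u x ≤ M) :
    IsLocallyCompactIn Ω {x ∈ Ω | u x = M} := by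
  intro z r hr
  have h : {x ∈ Ω | u x = M} ∩ closedBall z r = closedBall z r ∩ u ⁻¹' Ici M := by
    ext x
    exact ⟨fun hx => ⟨hx.2, hx.1.2.ge⟩,
      fun hx => ⟨⟨hr hx.1, (hmax x (hr hx.1)).antisymm hx.2⟩, hx.1⟩⟩
  rw [h]
  obtain ⟨C, hC, hCeq⟩ := upperSemicontinuousOn_iff_preimage_Ici.1 (husc.mono hr) M
  rw [hCeq]
  exact (isCompact_closedBall z r).inter_right hC

end Propagation

/-- Corollary 1.3, Strong Maximum Principle: if `F` admits smooth subunit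
vector fields satisfying the Hörmander condition, then any viscosity subsolution attaining a
nonnegative maximum in `Ω` is constant. -/
theorem strong_maximum_principle_hormander {d m : ℕ} (Ω : Set (EV d))
    (hΩ : IsOpen Ω) (hconn : IsConnected Ω)
    (F : EV d → ℝ → EV d → Matrix (Fin d) (Fin d) ℝ → ℝ)
    (hFlsc : IsLscOperator Ω F) (hFprop : IsProper Ω F) (hFscal : HasScaling Ω F)
    (Z : Fin m → EV d → EV d)
    (hZsmooth : ∀ i, ContDiffOn ℝ (⊤ : ℕ∞) (Z i) Ω)
    (hZsv : ∀ i, ∀ x ∈ Ω, IsSubunitAt F x (Z i x))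
    (hhor : Hormander Ω Z)
    (u : EV d → ℝ) (husc : UpperSemicontinuousOn u Ω)
    (hsub : IsViscSubsol Ω F u)
    (x₀ : EV d) (hx₀ : x₀ ∈ Ω) (hmax : ∀ x ∈ Ω, u x ≤ u x₀) (hnn : 0 ≤ u x₀) :
    ∀ x ∈ Ω, u x = u x₀ := by
  have hK := isLocallyCompactIn_maxSet husc hmax
  have hKΩ : {x ∈ Ω | u x = u x₀} ⊆ Ω := fun x hx => hx.1
  have htan : ∀ W, LieGenerated Z W → IsTangentField Ω {x ∈ Ω | u x = u x₀} W := fun W hW =>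
    hW.isTangentField hΩ hZsmooth hK hKΩ fun i =>
      hsub.isTangentField_of_isSubunitAt hΩ hFlsc hFprop hFscal husc hnn hmax (hZsv i)
  have heq := hK.eq_of_forall_isProximalCenter hΩ hconn.isPreconnected hKΩ ⟨x₀, hx₀, rfl⟩ ?_
  · exact fun x hx => (heq.symm.subset hx).2
  intro z c hc
  have horth : ∀ v : EV d, inner ℝ v (c - z) = 0 := by
    intro v
    have hv : v ∈ Submodule.span ℝ {v : EV d | ∃ W, LieGenerated Z W ∧ W z = v} := by
      rw [hhor z (hKΩ hc.1)]; trivial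
    induction hv using Submodule.span_induction with
    | mem v hv => obtain ⟨W, hW, rfl⟩ := hv; exact htan W hW z c hc
    | zero => exact inner_zero_left _
    | add v w _ _ hv hw => rw [inner_add_left, hv, hw, add_zero]
    | smul a v _ hv => rw [real_inner_smul_left, hv, mul_zero]
  exact sub_eq_zero.1 (inner_self_eq_zero.1 (horth (c - z)))
end
end

section
/- Let Ω ⊆ ℝ^d be open and connected, let F satisfy conditions (i) and (ii) and have a subunit vector field. Let u ∈ USC(Ω) be a viscosity subsolution of F(x,u,Du,D²u) = 0 achieving a nonnegative maximum at x ∈ Ω, and set K := Prop(x,u). Then for every z ∈ K* ∩ Ω and every generalized exterior normal ν to K at z, one has Z·ν = 0 for every generalized subunit vector Z of F at z. -/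
open Set Metric Filter Topology

noncomputable section

/-- The quadratic polynomial with value `0`, gradient `p` and Hessian `I - γ p ⊗ p` at `z`. -/
def quadTest {d : ℕ} (z p : EV d) (γ : ℝ) (y : EV d) : ℝ :=
  inner ℝ p (y - z) + ‖y - z‖ ^ 2 / 2 - γ / 2 * (inner ℝ p (y - z)) ^ 2

/-- The gradient of `quadTest`. -/
def quadTestGrad {d : ℕ} (z p : EV d) (γ : ℝ) (y : EV d) : EV d :=
  p + (y - z) - (γ * inner ℝ p (y - z)) • p

theorem contDiff_quadTest {d : ℕ} (z p : EV d) (γ : ℝ) : ContDiff ℝ 2 (quadTest z p γ) := by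
  have h : ContDiff ℝ 2 fun y : EV d => y - z := contDiff_id.sub contDiff_const
  have hi : ContDiff ℝ 2 fun y : EV d => (inner ℝ p (y - z) : ℝ) := contDiff_const.inner ℝ h
  exact (hi.add ((h.norm_sq ℝ).div_const 2)).sub (contDiff_const.mul (hi.pow 2))

theorem continuous_quadTestGrad {d : ℕ} (z p : EV d) (γ : ℝ) :
    Continuous (quadTestGrad z p γ) := by
  unfold quadTestGrad
  fun_prop

theorem hasFDerivAt_inner_sub {d : ℕ} (z p y : EV d) :
    HasFDerivAt (fun y : EV d => (inner ℝ p (y - z) : ℝ)) (innerSL ℝ p) y :=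
  (innerSL ℝ p).hasFDerivAt.comp y ((hasFDerivAt_id y).sub_const z)

theorem fderiv_const_mul_quadTest {d : ℕ} (z p : EV d) (γ ε : ℝ) (y h : EV d) :
    fderiv ℝ (fun y => ε * quadTest z p γ y) y h = ε * inner ℝ (quadTestGrad z p γ y) h := by
  have hi := hasFDerivAt_inner_sub z p y
  have hn : HasFDerivAt (fun y : EV d => ‖y - z‖ ^ 2) (2 • (innerSL ℝ (y - z))) y :=
    ((hasFDerivAt_id y).sub_const z).norm_sq
  have := ((hi.add (hn.mul_const (1 / 2 : ℝ))).sub ((hi.pow 2).const_mul (γ / 2))).const_mul ε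
  have h2 : (fun y => ε * quadTest z p γ y) = fun y : EV d =>
      ε * ((inner ℝ p (y - z) + ‖y - z‖ ^ 2 * (1 / 2)) - γ / 2 * (inner ℝ p (y - z)) ^ 2) := by
    funext y; simp only [quadTest]; ring
  rw [h2]
  erw [this.fderiv]
  simp only [quadTestGrad, inner_add_left, inner_sub_left, inner_smul_left]
  simp [-mul_eq_mul_left_iff]
  ring

theorem grad_const_mul_quadTest {d : ℕ} (z p : EV d) (γ ε : ℝ) (y : EV d) :
    grad (fun y => ε * quadTest z p γ y) y = ε • quadTestGrad z p γ y := by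
  ext i
  simp [grad, fderiv_const_mul_quadTest, EuclideanSpace.inner_single_right]

theorem hess_const_mul_quadTest {d : ℕ} (z p : EV d) (γ ε : ℝ) (y : EV d) :
    hess (fun y => ε * quadTest z p γ y) y = ε • (1 - γ • outer p) := by
  ext i j
  have hc : HasFDerivAt (fun y : EV d => (y - z) j) (EuclideanSpace.proj (𝕜 := ℝ) j : EV d →L[ℝ] ℝ) y :=
    (EuclideanSpace.proj (𝕜 := ℝ) j : EV d →L[ℝ] ℝ).hasFDerivAt.comp y
      ((hasFDerivAt_id y).sub_const z)
  have := (((hc.const_add (p j)).sub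
    (((hasFDerivAt_inner_sub z p y).const_mul γ).mul_const (p j)))).const_mul ε
  have h2 : (fun y => fderiv ℝ (fun y => ε * quadTest z p γ y) y (EuclideanSpace.single j 1)) =
      fun y : EV d => ε * ((p j + (y - z) j) - γ * inner ℝ p (y - z) * p j) := by
    funext y
    simp [fderiv_const_mul_quadTest, EuclideanSpace.inner_single_right, quadTestGrad]
  simp only [hess, Matrix.of_apply]
  rw [h2]
  erw [this.fderiv]
  simp [outer, Matrix.one_apply, EuclideanSpace.inner_single_right, eq_comm]
  ring_nf
  simp

/-- Near `z`, the sublevel set `quadTest ≤ 0` with gradient `-(t/2) ν` at `z` lies in the ball of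
radius `t` tangent at `z` with inner normal `ν`. -/
theorem mem_closedBall_of_quadTest_nonpos {d : ℕ} {z ν y : EV d} {t γ : ℝ} (hν : ‖ν‖ = 1)
    (ht : 0 < t) (hγ : 0 < γ) (hy : ‖y - z‖ * (γ * t) ≤ 2)
    (h : quadTest z (-(t / 2) • ν) γ y ≤ 0) : y ∈ closedBall (z + t • ν) t := by
  set w := y - z with hw
  set a : ℝ := inner ℝ ν w with ha
  have habs : |a| ≤ ‖w‖ := by
    have := abs_real_inner_le_norm ν w
    rwa [hν, one_mul] at this
  have hq : quadTest z (-(t / 2) • ν) γ y = -(t / 2) * a + ‖w‖ ^ 2 / 2 - γ / 2 * (t / 2 * a) ^ 2 := by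
    simp only [quadTest, inner_smul_left, ← hw, ← ha]
    simp
  rw [hq] at h
  have hγt : 0 < γ * t := mul_pos hγ ht
  obtain ⟨h1, h2⟩ := abs_le.mp habs
  have hl : -2 ≤ a * (γ * t) := by nlinarith
  have hu : a * (γ * t) ≤ 2 := by nlinarith
  have hfac : ‖w‖ ^ 2 ≤ t * a * (1 + a * (γ * t) / 4) := by nlinarith
  have ha0 : 0 ≤ a := by
    by_contra hneg
    push Not at hneg
    have : t * a * (1 + a * (γ * t) / 4) < 0 :=
      mul_neg_of_neg_of_pos (mul_neg_of_pos_of_neg ht hneg) (by linarith)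
    nlinarith [sq_nonneg ‖w‖]
  have hta : 0 ≤ t * a := mul_nonneg ht.le ha0
  have hle : ‖w‖ ^ 2 ≤ 2 * t * a := by nlinarith
  rw [mem_closedBall, dist_eq_norm]
  have hsub : y - (z + t • ν) = w - t • ν := by rw [hw]; abel
  rw [hsub]
  refine abs_le_of_sq_le_sq' ?_ ht.le |>.2
  rw [norm_sub_sq_real, inner_smul_right, real_inner_comm, ← ha, norm_smul, hν]
  simp only [Real.norm_eq_abs, mul_one, sq_abs]
  linarith

/-- An upper semicontinuous function that is `< M` on a compact set is bounded there by some
constant `< M`. -/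
theorem UpperSemicontinuousOn.exists_lt_forall_le {X : Type*} [TopologicalSpace X] {u : X → ℝ}
    {S : Set X} (hu : UpperSemicontinuousOn u S) (hS : IsCompact S) {M : ℝ}
    (h : ∀ x ∈ S, u x < M) : ∃ m < M, ∀ x ∈ S, u x ≤ m := by
  rcases S.eq_empty_or_nonempty with rfl | hne
  · exact ⟨M - 1, by linarith, by simp⟩
  · obtain ⟨x, hx, hxm⟩ := hu.exists_isMaxOn hne hS
    exact ⟨u x, h x hx, fun y hy => hxm hy⟩

/-- Proposition 2.4: the propagation set `K = Prop(x₀,u)` of a nonnegative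
interior maximum of a subsolution satisfies: at every point of `K* ∩ Ω`, every generalized
exterior normal to `K` is orthogonal to every generalized subunit vector of `F`. -/
theorem propagation_set_normals_orthogonal_to_subunit {d : ℕ} (Ω : Set (EV d))
    (hΩ : IsOpen Ω) (hconn : IsConnected Ω)
    (F : EV d → ℝ → EV d → Matrix (Fin d) (Fin d) ℝ → ℝ)
    (hFlsc : IsLscOperator Ω F) (hFprop : IsProper Ω F) (hFscal : HasScaling Ω F)
    (hSVF : ∃ Z : EV d → EV d, ∀ x ∈ Ω, IsSubunitAt F x (Z x))
    (u : EV d → ℝ) (husc : UpperSemicontinuousOn u Ω)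
    (hsub : IsViscSubsol Ω F u)
    (x₀ : EV d) (hx₀ : x₀ ∈ Ω) (hmax : ∀ x ∈ Ω, u x ≤ u x₀) (hnn : 0 ≤ u x₀) :
    ∀ z ∈ Ω, ∀ ν : EV d, IsExtNormal {y ∈ Ω | u y = u x₀} z ν →
      ∀ Z : EV d, IsSubunitAt F z Z → dotp Z ν = 0 := by
  intro z hz ν hN Z hZ
  obtain ⟨hzK, hν, t, ht, hball⟩ := hN
  by_contra hZν
  have huz : u z = u x₀ := by
    by_contra hne
    have hlt : u z < u x₀ := lt_of_le_of_ne (hmax z hz) hne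
    have hev := husc z hz _ hlt
    rw [hΩ.nhdsWithin_eq hz] at hev
    obtain ⟨y, hy1, hy2⟩ := (mem_closure_iff_frequently.mp hzK.1).and_eventually hev |>.exists
    exact absurd hy1.2 hy2.ne
  set p : EV d := -(t / 2) • ν with hp
  have hZp : dotp Z p ≠ 0 := by
    rw [dotp_eq_inner] at hZν ⊢
    rw [hp, inner_smul_right]
    exact mul_ne_zero (by linarith) hZν
  have hp0 : p ≠ 0 := by
    rintro h
    simp [h, dotp] at hZp
  obtain ⟨γ, hγ, hF⟩ := hZ p hZp
  have hsymm : (1 - γ • outer p : Matrix (Fin d) (Fin d) ℝ).IsSymm := by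
    ext i j
    simp [outer, Matrix.one_apply, eq_comm, mul_comm]
  set v := quadTest z p γ with hv
  have hvc : Continuous v := (contDiff_quadTest z p γ).continuous
  have hgc := continuous_quadTestGrad z p γ
  have hvz : v z = 0 := by simp [hv, quadTest]
  have hgz : quadTestGrad z p γ z = p := by simp [quadTestGrad]
  have hgood : ∀ᶠ x in 𝓝 z, x ∈ Ω ∧ quadTestGrad z p γ x ≠ 0 ∧ -1 < v x ∧
      ‖x - z‖ * (γ * t) < 2 ∧ 0 < F x (v x) (quadTestGrad z p γ x) (1 - γ • outer p) := by
    have e1 : ∀ᶠ x in 𝓝 z, x ∈ Ω := hΩ.mem_nhds hz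
    have e2 : ∀ᶠ x in 𝓝 z, quadTestGrad z p γ x ≠ 0 :=
      hgc.continuousAt.eventually_ne (by rwa [hgz])
    have e3 : ∀ᶠ x in 𝓝 z, -1 < v x :=
      hvc.continuousAt.eventually (lt_mem_nhds (by rw [hvz]; norm_num))
    have e4 : ∀ᶠ x in 𝓝 z, ‖x - z‖ * (γ * t) < 2 := by
      have : ContinuousAt (fun x : EV d => ‖x - z‖ * (γ * t)) z := by fun_prop
      exact this.eventually (gt_mem_nhds (by simp))
    have hlsc := hFlsc (z, 0, p, 1 - γ • outer p) ⟨hz, hp0, hsymm⟩ 0 hF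
    have htend : Tendsto (fun x => (x, v x, quadTestGrad z p γ x,
        (1 - γ • outer p : Matrix (Fin d) (Fin d) ℝ))) (𝓝 z) (𝓝 (z, 0, p, 1 - γ • outer p)) := by
      have : Continuous (fun x => (x, v x, quadTestGrad z p γ x,
        (1 - γ • outer p : Matrix (Fin d) (Fin d) ℝ))) := by fun_prop
      have := this.tendsto z
      rwa [hvz, hgz] at this
    have e5 := (tendsto_nhdsWithin_iff.mpr ⟨htend, by
      filter_upwards [e1, e2] with x h1 h2 using ⟨h1, h2, hsymm⟩⟩).eventually hlsc
    filter_upwards [e1, e2, e3, e4, e5] with x h1 h2 h3 h4 h5 using ⟨h1, h2, h3, h4, h5⟩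
  obtain ⟨r, hr, hgood⟩ := Metric.nhds_basis_closedBall.eventually_iff.mp hgood
  have hsubΩ : closedBall z r ⊆ Ω := fun x hx => (hgood hx).1
  have hSsub : sphere z r ∩ {x | v x ≤ 0} ⊆ Ω :=
    fun x hx => hsubΩ (sphere_subset_closedBall hx.1)
  obtain ⟨m, hmM, hm⟩ := (husc.mono hSsub).exists_lt_forall_le
    ((isCompact_sphere z r).inter_right (isClosed_le hvc continuous_const)) (M := u x₀) (by
      rintro x ⟨hxs, hxv⟩
      refine lt_of_le_of_ne (hmax x (hSsub ⟨hxs, hxv⟩)) fun hxe => ?_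
      have hxb := mem_closedBall_of_quadTest_nonpos hν ht hγ
        (hgood (sphere_subset_closedBall hxs)).2.2.2.1.le hxv
      have hxz : x ∈ ({z} : Set (EV d)) :=
        hball ▸ ⟨hxb, subset_closure ⟨hSsub ⟨hxs, hxv⟩, hxe⟩⟩
      rw [mem_singleton_iff.mp hxz, mem_sphere, dist_self] at hxs
      exact hr.ne hxs)
  set ε : ℝ := min 1 (u x₀ - m) with hε
  have hε0 : 0 < ε := lt_min one_pos (by linarith)
  have hε1 : ε ≤ 1 := min_le_left _ _
  have hεm : ε ≤ u x₀ - m := min_le_right _ _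
  have hbd : ∀ x ∈ sphere z r, u x < u x₀ + ε * v x := by
    intro x hx
    rcases le_or_gt (v x) 0 with h | h
    · have h1 := hm x ⟨hx, h⟩
      have h2 := (hgood (sphere_subset_closedBall hx)).2.2.1
      nlinarith
    · have h1 := hmax x (hsubΩ (sphere_subset_closedBall hx))
      have h2 := mul_pos hε0 h
      linarith
  have husc' : UpperSemicontinuousOn (fun x => u x + -(ε * v x)) (closedBall z r) :=
    (husc.mono hsubΩ).add
      ((continuous_const.mul hvc).neg.upperSemicontinuous.upperSemicontinuousOn _)
  obtain ⟨x, hx, hxmax⟩ := husc'.exists_isMaxOn ⟨z, mem_closedBall_self hr.le⟩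
    (isCompact_closedBall z r)
  have hxz : u x₀ + ε * v x ≤ u x := by
    have := hxmax (mem_closedBall_self hr.le)
    simp only [mem_ofPred_eq, hvz, huz] at this
    linarith
  have hxb : x ∈ ball z r := by
    rw [mem_ball]
    exact lt_of_le_of_ne hx fun h => (hbd x h).not_ge hxz
  obtain ⟨hxΩ, hgx, hvx, -, hFx⟩ := hgood hx
  have hloc : IsLocalMaxOn (fun y => u y - ε * v y) Ω x := by
    refine Filter.Eventually.filter_mono nhdsWithin_le_nhds ?_
    filter_upwards [isOpen_ball.mem_nhds hxb] with y hy
    have := hxmax (ball_subset_closedBall hy)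
    simp only [mem_ofPred_eq] at this
    linarith
  have hle := hsub (fun y => ε * v y) (contDiff_const.mul (contDiff_quadTest z p γ)) x hxΩ hloc
    (by rw [grad_const_mul_quadTest]; exact smul_ne_zero hε0.ne' hgx)
  rw [grad_const_mul_quadTest, hess_const_mul_quadTest] at hle
  have hvx0 : v x ≤ 0 := by
    have := hmax x hxΩ
    by_contra h
    have := mul_pos hε0 (not_le.mp h)
    linarith
  obtain ⟨φ, hφ, hscal⟩ := hFscal
  have h1 := hscal ε ⟨hε0, hε1⟩ (v x) ⟨hvx.le, hvx0⟩ x hxΩ _ hgx _ hsymm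
  have h2 := hFprop x hxΩ (ε * v x) (u x) (ε • quadTestGrad z p γ x)
    (ε • (1 - γ • outer p)) (ε • (1 - γ • outer p)) (by linarith)
    (by rw [sub_self]; exact Matrix.PosSemidef.zero)
  have h3 := mul_pos (hφ ε ⟨hε0, hε1⟩) hFx
  linarith
end
end
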